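/- arXiv:1112.6143 — 5 statements merged into one kernel-verified Lean document; each statement's English description precedes it below -/
import Mathlib

section
/- Let n ≥ 2, let g and ḡ be symmetric positive-definite real n×n matrices, let L and L̄ be skew-symmetric real n×n matrices, and let f : ℝⁿ → ℝ be a function such that for every v ∈ ℝⁿ one has the vector identity f(v)·v = √(vᵀḡv)·(ḡ⁻¹L̄v) − √(vᵀgv)·(g⁻¹Lv) in ℝⁿ. Then either there exists a real number α > 0 such that g = α²·ḡ and L = α·L̄, or L = 0 and L̄ = 0. -/
open Matrix

theorem Matrix.IsHermitian.exists_transpose_mul_mul_eq_diagonal_eigenvalues {ι : Type*}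
    [Fintype ι] [DecidableEq ι] {A : Matrix ι ι ℝ} (hA : A.IsHermitian) :
    ∃ U : Matrix ι ι ℝ, Uᵀ * U = 1 ∧ Uᵀ * A * U = diagonal hA.eigenvalues := by
  refine ⟨hA.eigenvectorUnitary, ?_, ?_⟩
  · simpa [star_eq_conjTranspose] using Unitary.coe_star_mul_self hA.eigenvectorUnitary
  · have h := hA.conjStarAlgAut_star_eigenvectorUnitary
    rw [Unitary.conjStarAlgAut_apply] at h
    simpa [star_eq_conjTranspose, Function.comp_def] using h

theorem Matrix.PosDef.exists_isUnit_transpose_mul_mul_eq_one {ι : Type*} [Fintype ι]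
    [DecidableEq ι] {A : Matrix ι ι ℝ} (hA : A.PosDef) :
    ∃ P : Matrix ι ι ℝ, IsUnit P ∧ Pᵀ * A * P = 1 := by
  obtain ⟨U, -, hd⟩ := hA.1.exists_transpose_mul_mul_eq_diagonal_eigenvalues
  let S : Matrix ι ι ℝ := diagonal fun i => (√(hA.1.eigenvalues i))⁻¹
  have hS : (U * S)ᵀ * A * (U * S) = 1 := by
    calc (U * S)ᵀ * A * (U * S) = S * (Uᵀ * A * U) * S := by
          simp [S, transpose_mul, Matrix.mul_assoc]
      _ = 1 := by
          rw [hd]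
          simp only [S, diagonal_mul_diagonal, ← diagonal_one]
          congr 1
          ext i
          have hp := hA.eigenvalues_pos i
          have hs := Real.sq_sqrt hp.le
          have : √(hA.1.eigenvalues i) ≠ 0 := (Real.sqrt_pos.2 hp).ne'
          field_simp
          exact hs.symm
  exact ⟨U * S, IsUnit.of_mul_eq_one_right _ hS, hS⟩

/-- Simultaneous diagonalization of two positive definite forms. -/
theorem Matrix.PosDef.exists_isUnit_simultaneous_diagonalization {ι : Type*} [Fintype ι]
    [DecidableEq ι] {A B : Matrix ι ι ℝ} (hA : A.PosDef) (hB : B.PosDef) :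
    ∃ (P : Matrix ι ι ℝ) (d : ι → ℝ), IsUnit P ∧ (∀ i, 0 < d i) ∧
      Pᵀ * A * P = 1 ∧ Pᵀ * B * P = diagonal d := by
  obtain ⟨Q, hQ, hQA⟩ := hA.exists_isUnit_transpose_mul_mul_eq_one
  have hC : (Qᵀ * B * Q).PosDef := by
    simpa [star_eq_conjTranspose] using hQ.posDef_star_left_conjugate_iff.2 hB
  obtain ⟨U, hU, hd⟩ := hC.1.exists_transpose_mul_mul_eq_diagonal_eigenvalues
  refine ⟨Q * U, hC.1.eigenvalues, hQ.mul (IsUnit.of_mul_eq_one_right _ hU),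
    hC.eigenvalues_pos, ?_, ?_⟩
  · calc (Q * U)ᵀ * A * (Q * U) = Uᵀ * (Qᵀ * A * Q) * U := by
          simp [transpose_mul, Matrix.mul_assoc]
      _ = 1 := by simp [hQA, hU]
  · calc (Q * U)ᵀ * B * (Q * U) = Uᵀ * (Qᵀ * B * Q) * U := by
          simp [transpose_mul, Matrix.mul_assoc]
      _ = _ := hd

theorem skew_eq_smul_or_eq_zero_of_diagonal {ι : Type*} [Fintype ι] [DecidableEq ι]
    {d : ι → ℝ} (hd : ∀ i, 0 < d i) {A B : Matrix ι ι ℝ} (hA : Aᵀ = -A) (hB : Bᵀ = -B)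
    (h : ∀ w : ι → ℝ, ∃ c : ℝ, ∀ j, c * (d j * w j) =
      √(w ⬝ᵥ w) * (d j * (A *ᵥ w) j) - √(w ⬝ᵥ diagonal d *ᵥ w) * (B *ᵥ w) j) :
    (∃ α : ℝ, 0 < α ∧ diagonal d = α ^ 2 • (1 : Matrix ι ι ℝ) ∧ B = α • A) ∨
      (B = 0 ∧ A = 0) := by
  have hA' (i j) : A j i = -A i j := by simpa using congr_fun₂ hA i j
  have hB' (i j) : B j i = -B i j := by simpa using congr_fun₂ hB i j
  have key (i j) : d j * A j i = √(d i) * B j i := by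
    by_cases hij : j = i
    · subst hij
      have h1 : A j j = 0 := by linarith [hA' j j]
      have h2 : B j j = 0 := by linarith [hB' j j]
      simp [h1, h2]
    · obtain ⟨c, hc⟩ := h (Pi.single i 1)
      have := hc j
      simp [hij, mulVec_single] at this
      linarith
  have hs (i) : 0 < √(d i) := Real.sqrt_pos.2 (hd i)
  have hsq (i) : √(d i) ^ 2 = d i := Real.sq_sqrt (hd i).le
  have eq_of_ne (i j) (hij : B i j ≠ 0) : d i = d j := by
    have h1 := key i j
    have h2 := key j i
    rw [hA' i j, hB' i j] at h1
    have h3 : (√(d i) ^ 3 - √(d j) ^ 3) * B i j = 0 := by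
      linear_combination √(d i) * B i j * hsq i - √(d j) * B i j * hsq j + d i * h1 + d j * h2
    have h4 : √(d i) ^ 3 = √(d j) ^ 3 := by
      have := (mul_eq_zero.1 h3).resolve_right hij
      linarith
    have h5 := (pow_left_inj₀ (hs i).le (hs j).le (by norm_num)).1 h4
    rw [← hsq i, ← hsq j, h5]
  by_cases hB0 : B = 0
  · refine .inr ⟨hB0, ?_⟩
    ext j i
    have := key i j
    simpa [hB0, (hd j).ne'] using this
  left
  obtain ⟨i, j, hij⟩ : ∃ i j, B i j ≠ 0 := by
    by_contra! hcon
    exact hB0 (ext hcon)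
  have hdij := eq_of_ne i j hij
  have hne : j ≠ i := by
    rintro rfl
    exact hij (by linarith [hB' j j])
  have all_eq (k) : d k = d i := by
    by_contra hk
    have hki : k ≠ i := by rintro rfl; exact hk rfl
    have hkj : j ≠ k := by rintro rfl; exact hk hdij.symm
    have hBjk : B j k = 0 := by
      by_contra hne'
      exact hk ((eq_of_ne j k hne').symm.trans hdij.symm)
    have hAjk : A j k = 0 := by
      have := key k j
      simpa [hBjk, (hd j).ne'] using this
    obtain ⟨c, hc⟩ := h (Pi.single i 1 + Pi.single k 1)
    have h1 := hc j
    simp [hne, hkj, mulVec_add, mulVec_single, hBjk, hAjk, hki, hki.symm] at h1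
    rw [key i j] at h1
    have hBji : B j i ≠ 0 := by rw [hB' i j]; exact neg_ne_zero.2 hij
    have h2 : √(1 + 1) * √(d i) = √(d i + d k) := by
      apply mul_right_cancel₀ hBji
      linarith
    rw [← Real.sqrt_mul (by norm_num)] at h2
    have h3 := (Real.sqrt_inj (by linarith [hd i]) (by linarith [hd i, hd k])).1 h2
    exact hk (by linarith)
  refine ⟨√(d i), hs i, ?_, ?_⟩
  · rw [hsq i, smul_one_eq_diagonal]
    congr 1
    exact funext all_eq
  · ext a b
    have := key b a
    rw [all_eq a, all_eq b, ← hsq i, Real.sqrt_sq (hs i).le] at this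
    apply mul_left_cancel₀ (hs i).ne'
    rw [Matrix.smul_apply, smul_eq_mul]
    linarith

theorem stmt_0 (n : ℕ) (hn : 2 ≤ n)
    (g gbar L Lbar : Matrix (Fin n) (Fin n) ℝ)
    (hgsymm : g.IsSymm) (hgpd : g.PosDef)
    (hgbarsymm : gbar.IsSymm) (hgbarpd : gbar.PosDef)
    (hL : Lᵀ = -L) (hLbar : Lbarᵀ = -Lbar)
    (f : (Fin n → ℝ) → ℝ)
    (hf : ∀ v : Fin n → ℝ,
      f v • v =
        Real.sqrt (v ⬝ᵥ gbar.mulVec v) • (gbar⁻¹.mulVec (Lbar.mulVec v)) -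
        Real.sqrt (v ⬝ᵥ g.mulVec v) • (g⁻¹.mulVec (L.mulVec v))) :
    (∃ α : ℝ, 0 < α ∧ g = (α ^ 2) • gbar ∧ L = α • Lbar) ∨ (L = 0 ∧ Lbar = 0) := by
  obtain ⟨P, d, hP, hd, hPgbar, hPg⟩ :=
    hgbarpd.exists_isUnit_simultaneous_diagonalization hgpd
  have hPt : IsUnit Pᵀ := isUnit_transpose P |>.2 hP
  have cancel {X Y : Matrix (Fin n) (Fin n) ℝ} (hXY : Pᵀ * X * P = Pᵀ * Y * P) : X = Y :=
    hPt.mul_left_cancel (hP.mul_right_cancel hXY)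
  have skew {X : Matrix (Fin n) (Fin n) ℝ} (hX : Xᵀ = -X) :
      (Pᵀ * X * P)ᵀ = -(Pᵀ * X * P) := by
    simp [transpose_mul, hX, Matrix.mul_assoc]
  have form (X : Matrix (Fin n) (Fin n) ℝ) (w : Fin n → ℝ) :
      (P *ᵥ w) ⬝ᵥ X *ᵥ (P *ᵥ w) = w ⬝ᵥ (Pᵀ * X * P) *ᵥ w := by
    rw [Matrix.mul_assoc, ← mulVec_mulVec, ← mulVec_mulVec, dotProduct_mulVec w, vecMul_transpose]
  have hinv : gbar⁻¹ = P * Pᵀ := by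
    apply inv_eq_left_inv
    rw [Matrix.mul_assoc]
    exact mul_eq_one_comm.1 hPgbar
  have hgg : Pᵀ * g * gbar⁻¹ = diagonal d * Pᵀ := by
    rw [hinv, ← hPg]
    simp only [Matrix.mul_assoc]
  have hg1 : Pᵀ * g * g⁻¹ = Pᵀ := by
    rw [Matrix.mul_assoc, mul_nonsing_inv _ ((isUnit_iff_isUnit_det g).1 hgpd.isUnit),
      Matrix.mul_one]
  have key (w : Fin n → ℝ) : ∃ c : ℝ, ∀ j, c * (d j * w j) =
      √(w ⬝ᵥ w) * (d j * ((Pᵀ * Lbar * P) *ᵥ w) j) -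
        √(w ⬝ᵥ diagonal d *ᵥ w) * ((Pᵀ * L * P) *ᵥ w) j := by
    refine ⟨f (P *ᵥ w), fun j => ?_⟩
    have h := congrArg (fun x => ((Pᵀ * g) *ᵥ x) j) (hf (P *ᵥ w))
    rw [form, form, hPgbar, hPg, one_mulVec] at h
    simp only [mulVec_sub, mulVec_smul, mulVec_mulVec, Pi.sub_apply, Pi.smul_apply,
      smul_eq_mul] at h
    rw [hPg, ← Matrix.mul_assoc (Pᵀ * g), ← Matrix.mul_assoc (Pᵀ * g), hgg, hg1,
      mulVec_diagonal] at h
    rw [h]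
    simp only [Matrix.mul_assoc, ← mulVec_mulVec, mulVec_diagonal]
  rcases skew_eq_smul_or_eq_zero_of_diagonal hd (skew hLbar) (skew hL) key with
    ⟨α, hα, hdα, hLα⟩ | ⟨h1, h2⟩
  · refine .inl ⟨α, hα, cancel ?_, cancel ?_⟩
    · simp [hPg, hdα, hPgbar]
    · simp [hLα]
  · exact .inr ⟨cancel (by simp [h1]), cancel (by simp [h2])⟩
end

section
/- Let n ≥ 2, let g and ḡ be symmetric positive-definite real n×n matrices, let L and L̄ be skew-symmetric real n×n matrices, and suppose there is a function f : ℝⁿ → ℝ such that for every v ∈ ℝⁿ one has f(v)·v = √(vᵀḡv)·(ḡ⁻¹L̄v) − √(vᵀgv)·(g⁻¹Lv) in ℝⁿ. Then for every v ∈ ℝⁿ the polynomial identity (vᵀḡv)³·⟨gv, ḡ⁻¹L̄v⟩² = (vᵀgv)³·⟨ḡv, g⁻¹Lv⟩² holds, where ⟨·,·⟩ is the standard inner product on ℝⁿ. -/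
open Matrix

section

variable {ι : Type*} [Fintype ι]

theorem Matrix.dotProduct_mulVec_self_eq_zero {L : Matrix ι ι ℝ} (hL : Lᵀ = -L) (v : ι → ℝ) :
    v ⬝ᵥ L *ᵥ v = 0 := by
  have h : v ⬝ᵥ L *ᵥ v = -(v ⬝ᵥ L *ᵥ v) := by
    conv_lhs => rw [dotProduct_mulVec, ← mulVec_transpose, hL, neg_mulVec, neg_dotProduct,
      dotProduct_comm]
  linarith

theorem Matrix.mulVec_dotProduct_inv_mulVec [DecidableEq ι] {g : Matrix ι ι ℝ} (hg : g.IsSymm)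
    (hdet : IsUnit g.det) (v w : ι → ℝ) : g *ᵥ v ⬝ᵥ g⁻¹ *ᵥ w = v ⬝ᵥ w := by
  rw [dotProduct_mulVec, ← mulVec_transpose, transpose_nonsing_inv, hg.eq, mulVec_mulVec,
    nonsing_inv_mul _ hdet, one_mulVec]

end

theorem stmt_2 (n : ℕ) (hn : 2 ≤ n)
    (g gbar L Lbar : Matrix (Fin n) (Fin n) ℝ)
    (hgsymm : g.IsSymm) (hgpd : g.PosDef)
    (hgbarsymm : gbar.IsSymm) (hgbarpd : gbar.PosDef)
    (hL : Lᵀ = -L) (hLbar : Lbarᵀ = -Lbar)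
    (f : (Fin n → ℝ) → ℝ)
    (hf : ∀ v : Fin n → ℝ,
      f v • v =
        Real.sqrt (v ⬝ᵥ gbar.mulVec v) • (gbar⁻¹.mulVec (Lbar.mulVec v)) -
        Real.sqrt (v ⬝ᵥ g.mulVec v) • (g⁻¹.mulVec (L.mulVec v))) :
    ∀ v : Fin n → ℝ,
      (v ⬝ᵥ gbar.mulVec v) ^ 3 * (g.mulVec v ⬝ᵥ gbar⁻¹.mulVec (Lbar.mulVec v)) ^ 2 =
      (v ⬝ᵥ g.mulVec v) ^ 3 * (gbar.mulVec v ⬝ᵥ g⁻¹.mulVec (L.mulVec v)) ^ 2 := by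
  intro v
  have ha : 0 ≤ v ⬝ᵥ gbar *ᵥ v := by simpa using hgbarpd.posSemidef.dotProduct_mulVec_nonneg v
  have hb : 0 ≤ v ⬝ᵥ g *ᵥ v := by simpa using hgpd.posSemidef.dotProduct_mulVec_nonneg v
  have hX := congrArg (g *ᵥ v ⬝ᵥ ·) (hf v)
  have hY := congrArg (gbar *ᵥ v ⬝ᵥ ·) (hf v)
  simp only [dotProduct_sub, dotProduct_smul, smul_eq_mul, dotProduct_comm _ v,
    mulVec_dotProduct_inv_mulVec hgsymm hgpd.det_pos.ne'.isUnit,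
    mulVec_dotProduct_inv_mulVec hgbarsymm hgbarpd.det_pos.ne'.isUnit,
    dotProduct_mulVec_self_eq_zero hL, dotProduct_mulVec_self_eq_zero hLbar] at hX hY
  have hsa := Real.sq_sqrt ha
  have hsb := Real.sq_sqrt hb
  generalize v ⬝ᵥ gbar *ᵥ v = a at *
  generalize v ⬝ᵥ g *ᵥ v = b at *
  generalize g *ᵥ v ⬝ᵥ gbar⁻¹ *ᵥ (Lbar *ᵥ v) = x at *
  generalize gbar *ᵥ v ⬝ᵥ g⁻¹ *ᵥ (L *ᵥ v) = y at *
  have key : a * (√a * x) = -(b * (√b * y)) := by linear_combination b * hY - a * hX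
  calc a ^ 3 * x ^ 2 = (a * (√a * x)) ^ 2 := by linear_combination -(a ^ 2 * x ^ 2) * hsa
    _ = (b * (√b * y)) ^ 2 := by rw [key, neg_sq]
    _ = b ^ 3 * y ^ 2 := by linear_combination b ^ 2 * y ^ 2 * hsb
end

section
/- Let n ≥ 2 and let g be a symmetric positive-definite real n×n matrix. Then the homogeneous quadratic polynomial K = ∑_{i,j} g_{ij} X_i X_j, regarded as an element of the multivariate polynomial ring ℝ[X_1, …, X_n] (MvPolynomial (Fin n) ℝ), is irreducible. -/
open Matrix MvPolynomial

theorem MvPolynomial.exists_eq_C_add_sum_of_totalDegree_le_one {σ R : Type*} [Fintype σ]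
    [CommRing R] {f : MvPolynomial σ R} (hf : f.totalDegree ≤ 1) :
    ∃ (c : R) (a : σ → R), f = C c + ∑ i, a i • X i := by
  have hlin : homogeneousComponent 1 f ∈ Submodule.span R (Set.range (X : σ → MvPolynomial σ R)) :=
    homogeneousSubmodule_one_eq_span_X (R := R) (σ := σ) ▸ homogeneousComponent_mem 1 f
  obtain ⟨a, ha⟩ := Submodule.mem_span_range_iff_exists_fun R |>.mp hlin
  refine ⟨coeff 0 f, a, ?_⟩
  rw [ha, ← homogeneousComponent_zero]
  obtain h | h : f.totalDegree = 0 ∨ f.totalDegree = 1 := by omega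
  · rw [homogeneousComponent_eq_zero 1 f (by omega), add_zero, homogeneousComponent_zero]
    exact totalDegree_eq_zero_iff_eq_C.mp h
  · conv_lhs => rw [← sum_homogeneousComponent f, h]
    simp [Finset.sum_range_succ]

theorem MvPolynomial.exists_ne_zero_eval_eq_zero_of_totalDegree_eq_one {σ K : Type*} [Fintype σ]
    [Nontrivial σ] [Field K] {f : MvPolynomial σ K} (hf : f.totalDegree = 1) :
    ∃ x : σ → K, x ≠ 0 ∧ eval x f = 0 := by
  classical
  obtain ⟨c, a, rfl⟩ := exists_eq_C_add_sum_of_totalDegree_le_one hf.le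
  obtain ⟨k, hk⟩ : ∃ k, a k ≠ 0 := by
    by_contra! h
    simp [h] at hf
  obtain ⟨m, hm⟩ := exists_ne k
  refine ⟨Pi.single m 1 + Pi.single k (-(c + a m) / a k), fun h ↦ ?_, ?_⟩
  · simpa [hm] using congrFun h m
  · simp only [map_add, eval_C, map_sum, smul_eval, eval_X, Pi.add_apply, mul_add,
      Finset.sum_add_distrib, Pi.single_apply, mul_ite, mul_zero, Finset.sum_ite_eq',
      Finset.mem_univ, if_true]
    field_simp
    ring

theorem MvPolynomial.irreducible_of_totalDegree_eq_two_of_eval_ne_zero {σ K : Type*} [Fintype σ]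
    [Nontrivial σ] [Field K] {f : MvPolynomial σ K} (hf : f.totalDegree = 2)
    (h : ∀ x : σ → K, x ≠ 0 → eval x f ≠ 0) : Irreducible f where
  not_isUnit hu := by simp [(isUnit_iff_totalDegree_of_isReduced.mp hu).2] at hf
  isUnit_or_isUnit a b hab := by
    have ha : a ≠ 0 := by rintro rfl; simp [hab] at hf
    have hb : b ≠ 0 := by rintro rfl; simp [hab] at hf
    have isUnit_of_totalDegree {p : MvPolynomial σ K} (hp : p ≠ 0) (hdeg : p.totalDegree = 0) :
        IsUnit p := by
      rw [totalDegree_eq_zero_iff_eq_C.mp hdeg] at hp ⊢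
      exact (IsUnit.mk0 _ (by simpa using hp)).map C
    have hdeg : a.totalDegree + b.totalDegree = 2 := by
      rw [← totalDegree_mul_of_isDomain ha hb, ← hab, hf]
    have hane : a.totalDegree ≠ 1 := fun h1 ↦ by
      obtain ⟨x, hx, hax⟩ := exists_ne_zero_eval_eq_zero_of_totalDegree_eq_one h1
      exact h x hx (by simp [hab, hax])
    obtain ha0 | hb0 : a.totalDegree = 0 ∨ b.totalDegree = 0 := by omega
    · exact .inl (isUnit_of_totalDegree ha ha0)
    · exact .inr (isUnit_of_totalDegree hb hb0)

theorem stmt_3 (n : ℕ) (hn : 2 ≤ n)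
    (g : Matrix (Fin n) (Fin n) ℝ)
    (hgsymm : g.IsSymm) (hgpd : g.PosDef) :
    Irreducible
      (∑ i : Fin n, ∑ j : Fin n,
        MvPolynomial.C (g i j) * MvPolynomial.X i * MvPolynomial.X j :
        MvPolynomial (Fin n) ℝ) := by
  have : Nontrivial (Fin n) := Fin.nontrivial_iff_two_le.mpr hn
  have hne (x : Fin n → ℝ) (hx : x ≠ 0) :
      eval x (∑ i, ∑ j, C (g i j) * X i * X j : MvPolynomial (Fin n) ℝ) ≠ 0 := by
    convert! (hgpd.dotProduct_mulVec_pos hx).ne' using 1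
    simp only [map_sum, map_mul, eval_C, eval_X, dotProduct, mulVec, star_trivial, Finset.mul_sum]
    exact Finset.sum_congr rfl fun i _ ↦ Finset.sum_congr rfl fun j _ ↦ by ring
  refine irreducible_of_totalDegree_eq_two_of_eval_ne_zero ?_ hne
  refine IsHomogeneous.totalDegree (.sum _ _ _ fun i _ ↦ .sum _ _ _ fun j _ ↦ ?_) fun h0 ↦ ?_
  · exact (isHomogeneous_C_mul_X (g i j) i).mul (isHomogeneous_X ℝ j)
  · obtain ⟨x, hx⟩ := exists_ne (0 : Fin n → ℝ)
    exact hne x hx (by rw [h0, map_zero])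
end

section
/- Let n ≥ 2, let g and ḡ be symmetric positive-definite real n×n matrices, and let M and M̄ be arbitrary real n×n matrices. Suppose that for every v ∈ ℝⁿ one has (vᵀḡv)³·(vᵀM̄v)² = (vᵀgv)³·(vᵀMv)², and suppose there exists v ∈ ℝⁿ with vᵀM̄v ≠ 0. Then there exists a real number c > 0 such that ḡ = c·g. -/
open Matrix

open Polynomial in
/-- A nonzero real polynomial dividing another one of the same degree does so with a constant
quotient. -/
lemma exists_eq_C_mul_of_dvd_of_natDegree_eq {p q : ℝ[X]} (hp : p ≠ 0) (hq : q ≠ 0)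
    (hdeg : p.natDegree = q.natDegree) (h : p ∣ q) : ∃ k : ℝ, k ≠ 0 ∧ q = C k * p := by
  obtain ⟨r, rfl⟩ := h
  have hr : r ≠ 0 := right_ne_zero_of_mul hq
  rw [natDegree_mul hp hr] at hdeg
  obtain ⟨k, rfl⟩ := natDegree_eq_zero.mp (show r.natDegree = 0 by omega)
  exact ⟨k, by rintro rfl; simp at hr, mul_comm _ _⟩

open Polynomial in
/-- If `p` is a real quadratic without real roots, `q` and `r` are quadratics and
`q ^ 3 * r ^ 2 = p ^ 3 * s ^ 2`, then `q` is a constant multiple of `p`. -/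
lemma quadratic_eq_C_mul_of_cube_mul_sq_eq {p q r s : ℝ[X]} (hp : p.natDegree = 2)
    (hq : q.natDegree = 2) (hr : r.natDegree = 2) (hroot : ∀ t : ℝ, p.eval t ≠ 0)
    (h : q ^ 3 * r ^ 2 = p ^ 3 * s ^ 2) : ∃ k : ℝ, k ≠ 0 ∧ q = C k * p := by
  have hp0 : p ≠ 0 := by rintro rfl; simp at hp
  have hq0 : q ≠ 0 := by rintro rfl; simp at hq
  have hr0 : r ≠ 0 := by rintro rfl; simp at hr
  have hirr : Irreducible p := by
    rw [irreducible_iff_roots_eq_zero_of_degree_le_three (by omega) (by omega)]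
    refine Multiset.eq_zero_of_forall_notMem fun t ht => hroot t ?_
    exact (mem_roots'.mp ht).2
  have hprime : Prime p := hirr.prime
  refine exists_eq_C_mul_of_dvd_of_natDegree_eq hp0 hq0 (by omega) ?_
  have hdvd : p ∣ q ^ 3 * r ^ 2 := h ▸ ⟨p ^ 2 * s ^ 2, by ring⟩
  rcases hprime.dvd_or_dvd hdvd with h1 | h1
  · exact hprime.dvd_of_dvd_pow h1
  · obtain ⟨k, hk, rfl⟩ := exists_eq_C_mul_of_dvd_of_natDegree_eq hp0 hr0 (by omega)
      (hprime.dvd_of_dvd_pow h1)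
    have h2 : q ^ 3 * C k ^ 2 = p * s ^ 2 :=
      mul_left_cancel₀ (pow_ne_zero 2 hp0) (by linear_combination h)
    rcases hprime.dvd_or_dvd (⟨s ^ 2, h2⟩ : p ∣ q ^ 3 * C k ^ 2) with h3 | h3
    · exact hprime.dvd_of_dvd_pow h3
    · exact absurd (isUnit_of_dvd_unit h3 ((isUnit_C.mpr hk.isUnit).pow 2)) hirr.not_isUnit

open Polynomial in
/-- The polynomial whose value at `t` is the quadratic form of `A` at `u + t • w`. -/
noncomputable def quadraticFormOnLine {n : ℕ} (A : Matrix (Fin n) (Fin n) ℝ)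
    (u w : Fin n → ℝ) : ℝ[X] :=
  C (w ⬝ᵥ A.mulVec w) * X ^ 2 + C (u ⬝ᵥ A.mulVec w + w ⬝ᵥ A.mulVec u) * X
    + C (u ⬝ᵥ A.mulVec u)

lemma eval_quadraticFormOnLine {n : ℕ} (A : Matrix (Fin n) (Fin n) ℝ) (u w : Fin n → ℝ) (t : ℝ) :
    (quadraticFormOnLine A u w).eval t = (u + t • w) ⬝ᵥ A.mulVec (u + t • w) := by
  simp [quadraticFormOnLine, mulVec_add, mulVec_smul, add_dotProduct, dotProduct_add]
  ring

lemma natDegree_quadraticFormOnLine {n : ℕ} {A : Matrix (Fin n) (Fin n) ℝ} (u : Fin n → ℝ)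
    {w : Fin n → ℝ} (h : w ⬝ᵥ A.mulVec w ≠ 0) : (quadraticFormOnLine A u w).natDegree = 2 :=
  Polynomial.natDegree_quadratic h

/-- A symmetric real matrix is determined by its quadratic form. -/
lemma Matrix.IsSymm.ext_of_dotProduct_mulVec {n : ℕ} {A B : Matrix (Fin n) (Fin n) ℝ}
    (hA : A.IsSymm) (hB : B.IsSymm)
    (h : ∀ v : Fin n → ℝ, v ⬝ᵥ A.mulVec v = v ⬝ᵥ B.mulVec v) : A = B := by
  ext i j
  have hij := h (Pi.single i 1 + Pi.single j 1)
  have hi := h (Pi.single i 1)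
  have hj := h (Pi.single j 1)
  have hAij := hA.apply i j
  have hBij := hB.apply i j
  simp [mulVec_add, add_dotProduct, dotProduct_add] at hij hi hj
  linarith

theorem stmt_4 (n : ℕ) (hn : 2 ≤ n)
    (g gbar M Mbar : Matrix (Fin n) (Fin n) ℝ)
    (hgsymm : g.IsSymm) (hgpd : g.PosDef)
    (hgbarsymm : gbar.IsSymm) (hgbarpd : gbar.PosDef)
    (heq : ∀ v : Fin n → ℝ,
      (v ⬝ᵥ gbar.mulVec v) ^ 3 * (v ⬝ᵥ Mbar.mulVec v) ^ 2 =
      (v ⬝ᵥ g.mulVec v) ^ 3 * (v ⬝ᵥ M.mulVec v) ^ 2)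
    (hne : ∃ v : Fin n → ℝ, v ⬝ᵥ Mbar.mulVec v ≠ 0) :
    ∃ c : ℝ, 0 < c ∧ gbar = c • g := by
  obtain ⟨w, hw⟩ := hne
  have hw0 : w ≠ 0 := by rintro rfl; simp at hw
  have hpos : ∀ {v : Fin n → ℝ}, v ≠ 0 → 0 < v ⬝ᵥ g.mulVec v := fun hv => by
    simpa using hgpd.dotProduct_mulVec_pos hv
  have hgw := hpos hw0
  have hgbarw : 0 < w ⬝ᵥ gbar.mulVec w := by
    simpa using hgbarpd.dotProduct_mulVec_pos hw0
  refine ⟨(w ⬝ᵥ gbar.mulVec w) / (w ⬝ᵥ g.mulVec w), div_pos hgbarw hgw,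
    hgbarsymm.ext_of_dotProduct_mulVec (hgsymm.smul _) fun u => ?_⟩
  rw [smul_mulVec, dotProduct_smul, smul_eq_mul]
  by_cases hu : ∃ t : ℝ, u + t • w = 0
  · obtain ⟨t, ht⟩ := hu
    obtain rfl : u = -(t • w) := eq_neg_of_add_eq_zero_left ht
    simp [mulVec_smul, mulVec_neg]
    field_simp
  · push Not at hu
    obtain ⟨k, -, hk⟩ := quadratic_eq_C_mul_of_cube_mul_sq_eq
      (p := quadraticFormOnLine g u w) (q := quadraticFormOnLine gbar u w)
      (r := quadraticFormOnLine Mbar u w) (s := quadraticFormOnLine M u w)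
      (natDegree_quadraticFormOnLine u hgw.ne') (natDegree_quadraticFormOnLine u hgbarw.ne')
      (natDegree_quadraticFormOnLine u hw)
      (fun t => by rw [eval_quadraticFormOnLine]; exact (hpos (hu t)).ne')
      (Polynomial.funext fun t => by
        simpa only [Polynomial.eval_mul, Polynomial.eval_pow, eval_quadraticFormOnLine]
          using heq (u + t • w))
    have h0 := congrArg (Polynomial.coeff · 0) hk
    have h2 := congrArg (Polynomial.coeff · 2) hk
    simp [quadraticFormOnLine, Polynomial.coeff_X, Polynomial.coeff_C] at h0 h2
    rw [h0, h2]
    field_simp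
end

section
/- (Theorem 1 of the paper, in coordinates.) Let U ⊆ ℝⁿ (n ≥ 2) be open and connected, and let (g, ω) and (ḡ, ω̄) be Randers data on U. Suppose the two data are projectively equivalent, i.e. every forward Randers geodesic of (g, ω) is a forward Randers geodesic of (ḡ, ω̄). If at least one of the 1-forms ω, ω̄ is not closed (i.e. dω or dω̄ is not identically zero on U), then there exists a real constant c > 0 such that g(p) = c²·ḡ(p) for every p ∈ U and the 1-form ω − c·ω̄ is closed on U, i.e. d(ω − c·ω̄) ≡ 0 on U. -/
open Matrix

/-- The partial derivative `∂f/∂x^k` of a scalar function on `ℝⁿ` at a point `p`. -/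
noncomputable def dpart {n : ℕ} (f : (Fin n → ℝ) → ℝ) (k : Fin n) (p : Fin n → ℝ) : ℝ :=
  fderiv ℝ f p (Pi.single k 1)

/-- The differential `dω` of a 1-form `ω` (given by its components), as a
skew-symmetric-matrix-valued map: `(dω)_{ik} = ∂ω_i/∂x^k − ∂ω_k/∂x^i`. -/
noncomputable def dform {n : ℕ} (ω : (Fin n → ℝ) → (Fin n → ℝ)) (p : Fin n → ℝ) :
    Matrix (Fin n) (Fin n) ℝ :=
  Matrix.of fun i k => dpart (fun q => ω q i) k p - dpart (fun q => ω q k) i p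

/-- The 1-form `ω` is closed on `U`. -/
def IsClosedFormOn {n : ℕ} (U : Set (Fin n → ℝ)) (ω : (Fin n → ℝ) → (Fin n → ℝ)) : Prop :=
  ∀ p ∈ U, dform ω p = 0

/-- `(g, ω)` is a Randers datum on `U`: `g` is a `C²` field of symmetric positive-definite
matrices and `ω` is a `C²` field of components of a 1-form. -/
def IsRandersDatum {n : ℕ} (U : Set (Fin n → ℝ))
    (g : (Fin n → ℝ) → Matrix (Fin n) (Fin n) ℝ)
    (ω : (Fin n → ℝ) → (Fin n → ℝ)) : Prop :=
  (∀ p ∈ U, (g p).IsSymm ∧ (g p).PosDef) ∧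
  (∀ i j, ContDiffOn ℝ 2 (fun q => g q i j) U) ∧
  (∀ i, ContDiffOn ℝ 2 (fun q => ω q i) U)

/-- `x : I → U` is a forward Randers geodesic of `(g, ω)`: `I` is an open interval, `x` is a
`C²` curve in `U` with nowhere-vanishing derivative satisfying the Euler–Lagrange equation of
the Randers length functional. -/
def IsRandersGeodesic {n : ℕ} (U : Set (Fin n → ℝ))
    (g : (Fin n → ℝ) → Matrix (Fin n) (Fin n) ℝ)
    (ω : (Fin n → ℝ) → (Fin n → ℝ))
    (I : Set ℝ) (x : ℝ → (Fin n → ℝ)) : Prop :=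
  IsOpen I ∧ I.OrdConnected ∧ (∀ t ∈ I, x t ∈ U) ∧
  ContDiffOn ℝ 2 x I ∧ (∀ t ∈ I, deriv x t ≠ 0) ∧
  ∀ t ∈ I, ∀ j : Fin n,
    deriv (deriv x) t j / Real.sqrt (∑ k, ∑ m, g (x t) k m * deriv x t k * deriv x t m)
    + deriv x t j *
        deriv (fun s => 1 / Real.sqrt (∑ k, ∑ m, g (x s) k m * deriv x s k * deriv x s m)) t
    + (1 / Real.sqrt (∑ k, ∑ m, g (x t) k m * deriv x t k * deriv x t m)) *
        ∑ i, ∑ k, ∑ p, (g (x t))⁻¹ j i * dpart (fun q => g q i p) k (x t) *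
          deriv x t k * deriv x t p
    + ∑ i, ∑ k, (g (x t))⁻¹ j i *
        (dpart (fun q => ω q i) k (x t) - dpart (fun q => ω q k) i (x t)) * deriv x t k
    - (1 / (2 * Real.sqrt (∑ k, ∑ m, g (x t) k m * deriv x t k * deriv x t m))) *
        ∑ i, ∑ p, ∑ q, (g (x t))⁻¹ j i * dpart (fun r => g r p q) i (x t) *
          deriv x t p * deriv x t q
    = 0

/-- A real polynomial of degree at most two that vanishes at a non-real point is a multiple of
any other one that does. -/
theorem quadratic_proportional_of_common_root {z : ℂ} (hz : z.im ≠ 0) {a₀ a₁ a₂ b₀ b₁ b₂ : ℝ}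
    (ha : (a₀ : ℂ) + a₁ * z + a₂ * z ^ 2 = 0) (hb : (b₀ : ℂ) + b₁ * z + b₂ * z ^ 2 = 0) :
    a₂ * b₀ = b₂ * a₀ ∧ a₂ * b₁ = b₂ * a₁ := by
  have h : ((a₂ * b₀ - b₂ * a₀ : ℝ) : ℂ) + ((a₂ * b₁ - b₂ * a₁ : ℝ) : ℂ) * z = 0 := by
    push_cast
    linear_combination (a₂ : ℂ) * hb - (b₂ : ℂ) * ha
  have him := congrArg Complex.im h
  have hre := congrArg Complex.re h
  simp only [Complex.add_im, Complex.ofReal_im, Complex.im_ofReal_mul, zero_add,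
    Complex.zero_im, mul_eq_zero, hz, or_false, Complex.add_re, Complex.ofReal_re,
    Complex.re_ofReal_mul, Complex.zero_re] at him hre
  rw [him] at hre
  constructor <;> linarith

/-- A positive definite real quadratic has a non-real root. -/
theorem exists_nonreal_root {b₀ b₁ b₂ : ℝ} (h2 : 0 < b₂) (hd : b₁ ^ 2 < 4 * b₀ * b₂) :
    ∃ z : ℂ, z.im ≠ 0 ∧ (b₀ : ℂ) + b₁ * z + b₂ * z ^ 2 = 0 := by
  have hpos : 0 < 4 * b₀ * b₂ - b₁ ^ 2 := by linarith
  set d := Real.sqrt (4 * b₀ * b₂ - b₁ ^ 2) with hdd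
  have hd0 : 0 < d := Real.sqrt_pos.mpr hpos
  have hsq : d ^ 2 = 4 * b₀ * b₂ - b₁ ^ 2 := Real.sq_sqrt hpos.le
  refine ⟨⟨-b₁ / (2 * b₂), d / (2 * b₂)⟩, by positivity, ?_⟩
  apply Complex.ext
  · simp [pow_two]
    field_simp
    linarith
  · simp [pow_two]
    field_simp
    ring

/-- A polynomial identity between two products of real quadratics persists over `ℂ`. -/
theorem quadratic_identity_complex {a₀ a₁ a₂ b₀ b₁ b₂ p₀ p₁ p₂ q₀ q₁ q₂ : ℝ}
    (h : ∀ s : ℝ, (a₀ + a₁ * s + a₂ * s ^ 2) * (p₀ + p₁ * s + p₂ * s ^ 2) ^ 2 =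
      (b₀ + b₁ * s + b₂ * s ^ 2) * (q₀ + q₁ * s + q₂ * s ^ 2) ^ 2) (z : ℂ) :
    ((a₀ : ℂ) + a₁ * z + a₂ * z ^ 2) * (p₀ + p₁ * z + p₂ * z ^ 2) ^ 2 =
      (b₀ + b₁ * z + b₂ * z ^ 2) * (q₀ + q₁ * z + q₂ * z ^ 2) ^ 2 := by
  let Q (c₀ c₁ c₂ : ℝ) : Polynomial ℝ :=
    Polynomial.C c₀ + Polynomial.C c₁ * Polynomial.X + Polynomial.C c₂ * Polynomial.X ^ 2
  have hP : Q a₀ a₁ a₂ * Q p₀ p₁ p₂ ^ 2 = Q b₀ b₁ b₂ * Q q₀ q₁ q₂ ^ 2 :=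
    Polynomial.funext fun s => by simpa [Q] using h s
  simpa [Q] using congrArg (Polynomial.aeval z) hP

/-- If `a p² = b q²` with `a`, `b` positive definite real quadratics and `p`, `q` of degree at most
two, `p` nonzero, then `a` and `b` are proportional. -/
theorem quadratic_proportional {a₀ a₁ a₂ b₀ b₁ b₂ p₀ p₁ p₂ q₀ q₁ q₂ : ℝ}
    (ha2 : 0 < a₂) (ha : a₁ ^ 2 < 4 * a₀ * a₂) (hb2 : 0 < b₂) (hb : b₁ ^ 2 < 4 * b₀ * b₂)
    (hp : p₀ ≠ 0)
    (h : ∀ s : ℝ, (a₀ + a₁ * s + a₂ * s ^ 2) * (p₀ + p₁ * s + p₂ * s ^ 2) ^ 2 =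
      (b₀ + b₁ * s + b₂ * s ^ 2) * (q₀ + q₁ * s + q₂ * s ^ 2) ^ 2) :
    a₂ * b₀ = b₂ * a₀ := by
  obtain ⟨z, hz, hzb⟩ := exists_nonreal_root hb2 hb
  have hC := quadratic_identity_complex h z
  rw [hzb, zero_mul] at hC
  rcases mul_eq_zero.mp hC with hza | hzp
  · exact (quadratic_proportional_of_common_root hz hza hzb).1
  have hzp := (pow_eq_zero_iff two_ne_zero).mp hzp
  obtain ⟨e0, e1⟩ := quadratic_proportional_of_common_root hz hzp hzb
  have hp2 : p₂ ≠ 0 := by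
    rintro rfl
    rw [zero_mul, eq_comm] at e0
    exact hp ((mul_eq_zero.mp e0).resolve_left hb2.ne')
  obtain ⟨y, hy, hya⟩ := exists_nonreal_root ha2 ha
  have hC' := quadratic_identity_complex h y
  rw [hya, zero_mul, eq_comm] at hC'
  rcases mul_eq_zero.mp hC' with hyb | hyq
  · exact (quadratic_proportional_of_common_root hy hya hyb).1
  obtain ⟨f0, f1⟩ :=
    quadratic_proportional_of_common_root hy ((pow_eq_zero_iff two_ne_zero).mp hyq) hya
  have hapos (s : ℝ) : a₀ + a₁ * s + a₂ * s ^ 2 ≠ 0 := by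
    intro h0
    nlinarith [sq_nonneg (2 * a₂ * s + a₁)]
  have hbpos (s : ℝ) : b₀ + b₁ * s + b₂ * s ^ 2 ≠ 0 := by
    intro h0
    nlinarith [sq_nonneg (2 * b₂ * s + b₁)]
  have h' (s : ℝ) : a₂ ^ 2 * p₂ ^ 2 * (b₀ + b₁ * s + b₂ * s ^ 2) =
      b₂ ^ 2 * q₂ ^ 2 * (a₀ + a₁ * s + a₂ * s ^ 2) := by
    have e : b₂ * (p₀ + p₁ * s + p₂ * s ^ 2) = p₂ * (b₀ + b₁ * s + b₂ * s ^ 2) := by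
      linear_combination -e0 - s * e1
    have f : a₂ * (q₀ + q₁ * s + q₂ * s ^ 2) = q₂ * (a₀ + a₁ * s + a₂ * s ^ 2) := by
      linear_combination -f0 - s * f1
    apply mul_left_cancel₀ (mul_ne_zero (hapos s) (hbpos s))
    calc _ = a₂ ^ 2 * (a₀ + a₁ * s + a₂ * s ^ 2) * (p₂ * (b₀ + b₁ * s + b₂ * s ^ 2)) ^ 2 := by ring
      _ = a₂ ^ 2 * b₂ ^ 2 *
          ((a₀ + a₁ * s + a₂ * s ^ 2) * (p₀ + p₁ * s + p₂ * s ^ 2) ^ 2) := by rw [← e]; ring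
      _ = b₂ ^ 2 * (b₀ + b₁ * s + b₂ * s ^ 2) * (a₂ * (q₀ + q₁ * s + q₂ * s ^ 2)) ^ 2 := by
        rw [h s]; ring
      _ = _ := by rw [f]; ring
  have g0 := h' 0
  have g2 : a₂ ^ 2 * p₂ ^ 2 * b₂ = b₂ ^ 2 * q₂ ^ 2 * a₂ := by
    linear_combination (h' 1 + h' (-1)) / 2 - g0
  apply mul_left_cancel₀ (show a₂ ^ 2 * p₂ ^ 2 ≠ 0 by positivity)
  linear_combination a₂ * g0 - a₀ * g2

theorem dotProduct_mulVec_comm_of_isSymm {n : ℕ} {M : Matrix (Fin n) (Fin n) ℝ} (hM : M.IsSymm)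
    (u v : Fin n → ℝ) : u ⬝ᵥ M *ᵥ v = v ⬝ᵥ M *ᵥ u := by
  rw [dotProduct_mulVec, ← mulVec_transpose, hM.eq, dotProduct_comm]

/-- A symmetric matrix whose quadratic form vanishes on a nonempty open set is zero. -/
theorem Matrix.IsSymm.eq_zero_of_quadratic_eq_zero {n : ℕ} {M : Matrix (Fin n) (Fin n) ℝ}
    (hM : M.IsSymm) {O : Set (Fin n → ℝ)} (hO : IsOpen O) {v₀ : Fin n → ℝ} (hv₀ : v₀ ∈ O)
    (h : ∀ v ∈ O, v ⬝ᵥ M *ᵥ v = 0) : M = 0 := by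
  have hall (e : Fin n → ℝ) : e ⬝ᵥ M *ᵥ e = 0 := by
    have hc : Continuous fun s : ℝ => v₀ + s • e := by fun_prop
    have h1 : ∀ᶠ s : ℝ in nhds 0, v₀ + s • e ∈ O :=
      hc.continuousAt.eventually (by simpa using hO.mem_nhds hv₀)
    have h2 : ∀ᶠ s : ℝ in nhds 0, v₀ + (-s) • e ∈ O :=
      (hc.comp continuous_neg).continuousAt.eventually (by simpa using hO.mem_nhds hv₀)
    obtain ⟨s, ⟨h1, h2⟩, hs⟩ :=
      (((h1.and h2).filter_mono nhdsWithin_le_nhds).and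
        (self_mem_nhdsWithin : {0}ᶜ ∈ nhdsWithin (0 : ℝ) {0}ᶜ)).exists
    have e0 := h _ hv₀
    have e1 := h _ h1
    have e2 := h _ h2
    simp only [mulVec_add, mulVec_smul, add_dotProduct, dotProduct_add, smul_dotProduct,
      dotProduct_smul, smul_eq_mul] at e1 e2
    have : s ^ 2 * (e ⬝ᵥ M *ᵥ e) = 0 := by linarith
    exact (mul_eq_zero.mp this).resolve_left (pow_ne_zero 2 hs)
  ext i j
  have h1 := hall (Pi.single i 1)
  have h2 := hall (Pi.single j 1)
  have h3 := hall (Pi.single i 1 + Pi.single j 1)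
  have h4 := dotProduct_mulVec_comm_of_isSymm hM (Pi.single i 1) (Pi.single j 1)
  simp only [mulVec_add, add_dotProduct, dotProduct_add] at h3
  have h5 : (Pi.single i 1 : Fin n → ℝ) ⬝ᵥ M *ᵥ Pi.single j 1 = 0 := by linarith
  simpa using h5

theorem dotProduct_mulVec_self_of_skew {n : ℕ} {M : Matrix (Fin n) (Fin n) ℝ} (hM : Mᵀ = -M)
    (v : Fin n → ℝ) : v ⬝ᵥ M *ᵥ v = 0 := by
  have h : v ⬝ᵥ M *ᵥ v = -(v ⬝ᵥ M *ᵥ v) := by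
    conv_lhs => rw [dotProduct_mulVec, ← mulVec_transpose, hM, dotProduct_comm, neg_mulVec,
      dotProduct_neg]
  linarith

theorem Matrix.PosDef.quadratic_pos {n : ℕ} {A : Matrix (Fin n) (Fin n) ℝ} (hA : A.PosDef)
    {v : Fin n → ℝ} (hv : v ≠ 0) : 0 < v ⬝ᵥ A *ᵥ v := by
  simpa using hA.dotProduct_mulVec_pos hv

theorem Matrix.PosDef.mulVec_inv_mulVec {n : ℕ} {A : Matrix (Fin n) (Fin n) ℝ} (hA : A.PosDef)
    (v : Fin n → ℝ) : A *ᵥ (A⁻¹ *ᵥ v) = v := by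
  rw [mulVec_mulVec, mul_nonsing_inv _ hA.det_pos.ne'.isUnit, one_mulVec]

/-- A skew-symmetric form whose associated endomorphism has `v` as an eigenvector kills `v`. -/
theorem mulVec_eq_zero_of_skew_of_eigen {n : ℕ} {A Ω : Matrix (Fin n) (Fin n) ℝ} (hA : A.PosDef)
    (hΩ : Ωᵀ = -Ω) {v : Fin n → ℝ} {μ : ℝ} (h : A⁻¹ *ᵥ (Ω *ᵥ v) = μ • v) : Ω *ᵥ v = 0 := by
  have h1 : Ω *ᵥ v = μ • A *ᵥ v := by
    rw [← mulVec_smul, ← h, hA.mulVec_inv_mulVec]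
  by_cases hv : v = 0
  · simp [hv]
  have h2 := dotProduct_mulVec_self_of_skew hΩ v
  rw [h1, dotProduct_smul, smul_eq_mul] at h2
  rw [h1, (mul_eq_zero.mp h2).resolve_right (hA.quadratic_pos hv).ne', zero_smul]

theorem exists_smul_eq_of_minors_eq_zero {n : ℕ} {u v : Fin n → ℝ} (hv : v ≠ 0)
    (h : ∀ i j, u i * v j - u j * v i = 0) : ∃ μ : ℝ, u = μ • v := by
  obtain ⟨j, hj⟩ := Function.ne_iff.mp hv
  simp only [Pi.zero_apply] at hj
  refine ⟨u j / v j, funext fun i => ?_⟩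
  have := h i j
  simp only [Pi.smul_apply, smul_eq_mul]
  field_simp
  linarith

/-- The coefficients of the quadratic form of `A` along the line `u + s w`. -/
theorem quadratic_along_line {n : ℕ} {A : Matrix (Fin n) (Fin n) ℝ} (hA : A.IsSymm)
    (u w : Fin n → ℝ) (s : ℝ) :
    (u + s • w) ⬝ᵥ A *ᵥ (u + s • w) =
      u ⬝ᵥ A *ᵥ u + 2 * (u ⬝ᵥ A *ᵥ w) * s + (w ⬝ᵥ A *ᵥ w) * s ^ 2 := by
  have := dotProduct_mulVec_comm_of_isSymm hA u w
  simp only [mulVec_add, mulVec_smul, add_dotProduct, dotProduct_add, smul_dotProduct,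
    dotProduct_smul, smul_eq_mul]
  linear_combination -s * this

theorem quadratic_discrim_neg {n : ℕ} {A : Matrix (Fin n) (Fin n) ℝ} (hA : A.PosDef)
    (hS : A.IsSymm) {u w : Fin n → ℝ} (hw : w ≠ 0) (huw : ∀ s : ℝ, u + s • w ≠ 0) :
    (2 * (u ⬝ᵥ A *ᵥ w)) ^ 2 < 4 * (u ⬝ᵥ A *ᵥ u) * (w ⬝ᵥ A *ᵥ w) := by
  have hw' := hA.quadratic_pos hw
  have h := hA.quadratic_pos (huw (-(u ⬝ᵥ A *ᵥ w) / (w ⬝ᵥ A *ᵥ w)))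
  rw [quadratic_along_line hS] at h
  have h2 := mul_pos h hw'
  field_simp at h2
  nlinarith

/-- The key pointwise fact: if `√A(v) A⁻¹Ωv - √A'(v) A'⁻¹Ω'v` is always parallel to `v` and
`Ω` does not vanish, then `A` and `A'` are proportional. -/
theorem metrics_proportional_of_left {n : ℕ} {A A' Ω Ω' : Matrix (Fin n) (Fin n) ℝ}
    (hA : A.PosDef) (hS : A.IsSymm) (hA' : A'.PosDef) (hS' : A'.IsSymm) (hΩ : Ωᵀ = -Ω)
    (h : ∀ v : Fin n → ℝ, v ≠ 0 → ∃ μ : ℝ, √(v ⬝ᵥ A *ᵥ v) • (A⁻¹ *ᵥ (Ω *ᵥ v)) -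
      √(v ⬝ᵥ A' *ᵥ v) • (A'⁻¹ *ᵥ (Ω' *ᵥ v)) = μ • v) (hne : Ω ≠ 0) :
    ∃ φ : ℝ, 0 < φ ∧ A = φ • A' := by
  obtain ⟨u, hu⟩ : ∃ u, Ω *ᵥ u ≠ 0 := by
    by_contra! hc
    exact hne (Matrix.ext_of_mulVec_single fun i => by rw [hc, zero_mulVec])
  have hu0 : u ≠ 0 := by
    rintro rfl
    simp at hu
  obtain ⟨i, j, hij⟩ : ∃ i j, (A⁻¹ *ᵥ (Ω *ᵥ u)) i * u j - (A⁻¹ *ᵥ (Ω *ᵥ u)) j * u i ≠ 0 := by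
    by_contra! hc
    obtain ⟨μ, hμ⟩ := exists_smul_eq_of_minors_eq_zero hu0 hc
    exact hu (mulVec_eq_zero_of_skew_of_eigen hA hΩ hμ)
  have hA0 := hA.quadratic_pos hu0
  have hA0' := hA'.quadratic_pos hu0
  have hid (v : Fin n → ℝ) (hv : v ≠ 0) :
      (v ⬝ᵥ A *ᵥ v) * ((A⁻¹ *ᵥ (Ω *ᵥ v)) i * v j - (A⁻¹ *ᵥ (Ω *ᵥ v)) j * v i) ^ 2 =
      (v ⬝ᵥ A' *ᵥ v) * ((A'⁻¹ *ᵥ (Ω' *ᵥ v)) i * v j - (A'⁻¹ *ᵥ (Ω' *ᵥ v)) j * v i) ^ 2 := by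
    obtain ⟨μ, hμ⟩ := h v hv
    have hi := congrFun hμ i
    have hj := congrFun hμ j
    simp only [Pi.sub_apply, Pi.smul_apply, smul_eq_mul] at hi hj
    rw [← Real.sq_sqrt (hA.quadratic_pos hv).le, ← Real.sq_sqrt (hA'.quadratic_pos hv).le,
      ← mul_pow, ← mul_pow]
    congr 1
    linear_combination v j * hi - v i * hj
  have hprop (w : Fin n → ℝ) :
      (w ⬝ᵥ A *ᵥ w) * (u ⬝ᵥ A' *ᵥ u) = (w ⬝ᵥ A' *ᵥ w) * (u ⬝ᵥ A *ᵥ u) := by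
    by_cases hw : w = 0
    · simp [hw]
    by_cases hpar : ∃ s : ℝ, u + s • w = 0
    · obtain ⟨s, hs⟩ := hpar
      have : u = -(s • w) := eq_neg_of_add_eq_zero_left hs
      simp only [this, mulVec_neg, mulVec_smul, neg_dotProduct, dotProduct_neg, smul_dotProduct,
        dotProduct_smul, smul_eq_mul]
      ring
    push Not at hpar
    refine quadratic_proportional (hA.quadratic_pos hw) (quadratic_discrim_neg hA hS hw hpar)
      (hA'.quadratic_pos hw) (quadratic_discrim_neg hA' hS' hw hpar) hij
      (p₁ := (A⁻¹ *ᵥ (Ω *ᵥ w)) i * u j - (A⁻¹ *ᵥ (Ω *ᵥ w)) j * u i +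
        ((A⁻¹ *ᵥ (Ω *ᵥ u)) i * w j - (A⁻¹ *ᵥ (Ω *ᵥ u)) j * w i))
      (p₂ := (A⁻¹ *ᵥ (Ω *ᵥ w)) i * w j - (A⁻¹ *ᵥ (Ω *ᵥ w)) j * w i)
      (q₀ := (A'⁻¹ *ᵥ (Ω' *ᵥ u)) i * u j - (A'⁻¹ *ᵥ (Ω' *ᵥ u)) j * u i)
      (q₁ := (A'⁻¹ *ᵥ (Ω' *ᵥ w)) i * u j - (A'⁻¹ *ᵥ (Ω' *ᵥ w)) j * u i +
        ((A'⁻¹ *ᵥ (Ω' *ᵥ u)) i * w j - (A'⁻¹ *ᵥ (Ω' *ᵥ u)) j * w i))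
      (q₂ := (A'⁻¹ *ᵥ (Ω' *ᵥ w)) i * w j - (A'⁻¹ *ᵥ (Ω' *ᵥ w)) j * w i)
      fun s => ?_
    have := hid _ (hpar s)
    rw [quadratic_along_line hS, quadratic_along_line hS'] at this
    simp only [mulVec_add, mulVec_smul, Pi.add_apply, Pi.smul_apply, smul_eq_mul] at this
    convert this using 3 <;> ring
  refine ⟨(u ⬝ᵥ A *ᵥ u) / (u ⬝ᵥ A' *ᵥ u), div_pos hA0 hA0', ?_⟩
  rw [← sub_eq_zero]
  refine (hS.sub (hS'.smul _)).eq_zero_of_quadratic_eq_zero isOpen_univ (Set.mem_univ 0)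
    fun w _ => ?_
  rw [sub_mulVec, smul_mulVec, dotProduct_sub, dotProduct_smul, smul_eq_mul]
  field_simp
  linarith [hprop w]

theorem metrics_proportional {n : ℕ} {A A' Ω Ω' : Matrix (Fin n) (Fin n) ℝ}
    (hA : A.PosDef) (hS : A.IsSymm) (hA' : A'.PosDef) (hS' : A'.IsSymm) (hΩ : Ωᵀ = -Ω)
    (hΩ' : Ω'ᵀ = -Ω')
    (h : ∀ v : Fin n → ℝ, v ≠ 0 → ∃ μ : ℝ, √(v ⬝ᵥ A *ᵥ v) • (A⁻¹ *ᵥ (Ω *ᵥ v)) -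
      √(v ⬝ᵥ A' *ᵥ v) • (A'⁻¹ *ᵥ (Ω' *ᵥ v)) = μ • v) (hne : Ω ≠ 0 ∨ Ω' ≠ 0) :
    ∃ φ : ℝ, 0 < φ ∧ A = φ • A' := by
  rcases hne with hne | hne
  · exact metrics_proportional_of_left hA hS hA' hS' hΩ h hne
  · obtain ⟨φ, hφ, e⟩ := metrics_proportional_of_left hA' hS' hA hS hΩ' (Ω' := Ω) (fun v hv => by
      obtain ⟨μ, hμ⟩ := h v hv
      exact ⟨-μ, by rw [neg_smul, ← hμ, neg_sub]⟩) hne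
    exact ⟨φ⁻¹, inv_pos.mpr hφ, by rw [e, smul_smul, inv_mul_cancel₀ hφ.ne', one_smul]⟩

theorem skew_proportional {n : ℕ} {A A' Ω Ω' : Matrix (Fin n) (Fin n) ℝ}
    (hA' : A'.PosDef) (hΩ : Ωᵀ = -Ω) (hΩ' : Ω'ᵀ = -Ω')
    (h : ∀ v : Fin n → ℝ, v ≠ 0 → ∃ μ : ℝ, √(v ⬝ᵥ A *ᵥ v) • (A⁻¹ *ᵥ (Ω *ᵥ v)) -
      √(v ⬝ᵥ A' *ᵥ v) • (A'⁻¹ *ᵥ (Ω' *ᵥ v)) = μ • v) {c : ℝ} (hc : 0 < c)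
    (hAA' : A = c ^ 2 • A') : Ω = c • Ω' := by
  rw [← sub_eq_zero]
  refine Matrix.ext_of_mulVec_single fun i => ?_
  rw [zero_mulVec]
  have hv : (Pi.single i 1 : Fin n → ℝ) ≠ 0 := by simp
  set v : Fin n → ℝ := Pi.single i 1
  obtain ⟨μ, hμ⟩ := h v hv
  have hN := Real.sqrt_pos.mpr (hA'.quadratic_pos hv)
  refine mulVec_eq_zero_of_skew_of_eigen hA' (μ := c * μ / √(v ⬝ᵥ A' *ᵥ v)) ?_ ?_
  · rw [transpose_sub, transpose_smul, hΩ, hΩ', smul_neg]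
    abel
  · have hinv : A⁻¹ = (c ^ 2)⁻¹ • A'⁻¹ := by
      rw [hAA']
      refine Matrix.inv_eq_left_inv ?_
      rw [smul_mul_smul_comm, inv_mul_cancel₀ (by positivity), one_smul,
        nonsing_inv_mul _ hA'.det_pos.ne'.isUnit]
    rw [hinv, hAA', smul_mulVec, dotProduct_smul, smul_eq_mul, Real.sqrt_mul (by positivity),
      Real.sqrt_sq hc.le] at hμ
    funext k
    have hk := congrFun hμ k
    simp only [smul_mulVec, mulVec_smul, sub_mulVec, mulVec_sub, Pi.sub_apply, Pi.smul_apply,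
      smul_eq_mul] at hk ⊢
    field_simp at hk ⊢
    linear_combination hk

/-- The derivative of a field of matrices at `p` in the direction `v`. -/
noncomputable def dirDeriv {n : ℕ} (g : (Fin n → ℝ) → Matrix (Fin n) (Fin n) ℝ)
    (p v : Fin n → ℝ) : Matrix (Fin n) (Fin n) ℝ :=
  Matrix.of fun i j => ∑ k, dpart (fun q => g q i j) k p * v k

/-- The Christoffel symbols of the first kind. -/
noncomputable def christoffel {n : ℕ} (g : (Fin n → ℝ) → Matrix (Fin n) (Fin n) ℝ)
    (p : Fin n → ℝ) (i k l : Fin n) : ℝ :=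
  (dpart (fun q => g q i l) k p + dpart (fun q => g q i k) l p - dpart (fun q => g q k l) i p) / 2

/-- The geodesic spray coefficients with lowered index. -/
noncomputable def lowSpray {n : ℕ} (g : (Fin n → ℝ) → Matrix (Fin n) (Fin n) ℝ)
    (p v : Fin n → ℝ) : Fin n → ℝ :=
  fun i => ∑ k, ∑ l, christoffel g p i k l * v k * v l

/-- The geodesic spray coefficients `Γ^j_{kl} v^k v^l`. -/
noncomputable def spray {n : ℕ} (g : (Fin n → ℝ) → Matrix (Fin n) (Fin n) ℝ)
    (p v : Fin n → ℝ) : Fin n → ℝ :=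
  (g p)⁻¹ *ᵥ lowSpray g p v

/-- The acceleration of a Randers geodesic parametrized with constant `g`-speed. -/
noncomputable def accel {n : ℕ} (g : (Fin n → ℝ) → Matrix (Fin n) (Fin n) ℝ)
    (ω : (Fin n → ℝ) → (Fin n → ℝ)) (p v : Fin n → ℝ) : Fin n → ℝ :=
  -spray g p v - √(v ⬝ᵥ g p *ᵥ v) • ((g p)⁻¹ *ᵥ (dform ω p *ᵥ v))

theorem lowSpray_eq {n : ℕ} (g : (Fin n → ℝ) → Matrix (Fin n) (Fin n) ℝ)
    (p v : Fin n → ℝ) (i : Fin n) :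
    lowSpray g p v i = (∑ k, ∑ l, dpart (fun q => g q i l) k p * v k * v l) -
      (∑ k, ∑ l, dpart (fun q => g q k l) i p * v k * v l) / 2 := by
  have h : ∑ k, ∑ l, dpart (fun q => g q i k) l p * v k * v l =
      ∑ k, ∑ l, dpart (fun q => g q i l) k p * v k * v l := by
    rw [Finset.sum_comm]
    exact Finset.sum_congr rfl fun k _ => Finset.sum_congr rfl fun l _ => by ring
  have h2 : lowSpray g p v i = ((∑ k, ∑ l, dpart (fun q => g q i l) k p * v k * v l) +
      (∑ k, ∑ l, dpart (fun q => g q i k) l p * v k * v l) -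
      ∑ k, ∑ l, dpart (fun q => g q k l) i p * v k * v l) / 2 := by
    simp only [lowSpray, christoffel, ← Finset.sum_add_distrib, ← Finset.sum_sub_distrib,
      Finset.sum_div]
    exact Finset.sum_congr rfl fun k _ => Finset.sum_congr rfl fun l _ => by ring
  rw [h2, h]
  ring

theorem dotProduct_lowSpray {n : ℕ} (g : (Fin n → ℝ) → Matrix (Fin n) (Fin n) ℝ)
    (p v : Fin n → ℝ) : v ⬝ᵥ lowSpray g p v = v ⬝ᵥ dirDeriv g p v *ᵥ v / 2 := by
  have h1 : ∑ i, v i * ∑ k, ∑ l, dpart (fun q => g q i l) k p * v k * v l =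
      v ⬝ᵥ dirDeriv g p v *ᵥ v := by
    simp only [dotProduct, mulVec, dirDeriv, of_apply, Finset.sum_mul]
    refine Finset.sum_congr rfl fun i _ => ?_
    rw [Finset.sum_comm]
  have h2 : ∑ i, v i * ∑ k, ∑ l, dpart (fun q => g q k l) i p * v k * v l =
      v ⬝ᵥ dirDeriv g p v *ᵥ v := by
    simp only [dotProduct, mulVec, dirDeriv, of_apply, Finset.sum_mul, Finset.mul_sum]
    rw [Finset.sum_comm]
    refine Finset.sum_congr rfl fun k _ => ?_
    rw [Finset.sum_comm]
    exact Finset.sum_congr rfl fun i _ => Finset.sum_congr rfl fun l _ => by ring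
  simp only [dotProduct, lowSpray_eq, mul_sub, Finset.sum_sub_distrib, mul_div_assoc',
    ← Finset.sum_div] at h1 h2 ⊢
  rw [h1, h2]
  ring

theorem dform_transpose {n : ℕ} (ω : (Fin n → ℝ) → (Fin n → ℝ)) (p : Fin n → ℝ) :
    (dform ω p)ᵀ = -dform ω p := by
  ext i j
  simp [dform]

theorem sum_sum_eq_quadratic {n : ℕ} (A : Matrix (Fin n) (Fin n) ℝ) (v : Fin n → ℝ) :
    ∑ k, ∑ m, A k m * v k * v m = v ⬝ᵥ A *ᵥ v := by
  simp only [dotProduct, mulVec, Finset.mul_sum]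
  exact Finset.sum_congr rfl fun k _ => Finset.sum_congr rfl fun l _ => by ring

/-- The left-hand side of the Euler–Lagrange equation in terms of the spray. -/
theorem eulerLagrange_eq {n : ℕ} (g : (Fin n → ℝ) → Matrix (Fin n) (Fin n) ℝ)
    (ω : (Fin n → ℝ) → (Fin n → ℝ)) (p v a : Fin n → ℝ) (r d : ℝ) (j : Fin n) :
    a j / r + v j * d
    + (1 / r) * ∑ i, ∑ k, ∑ l, (g p)⁻¹ j i * dpart (fun q => g q i l) k p * v k * v l
    + ∑ i, ∑ k, (g p)⁻¹ j i *
        (dpart (fun q => ω q i) k p - dpart (fun q => ω q k) i p) * v k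
    - (1 / (2 * r)) * ∑ i, ∑ k, ∑ l, (g p)⁻¹ j i * dpart (fun q => g q k l) i p * v k * v l
    = a j / r + v j * d + (1 / r) * spray g p v j + ((g p)⁻¹ *ᵥ (dform ω p *ᵥ v)) j := by
  have h1 : ∑ i, ∑ k, (g p)⁻¹ j i *
      (dpart (fun q => ω q i) k p - dpart (fun q => ω q k) i p) * v k =
      ((g p)⁻¹ *ᵥ (dform ω p *ᵥ v)) j := by
    simp only [mulVec, dotProduct, dform, of_apply, Finset.mul_sum, mul_assoc]
  have h2 : spray g p v j =
      (∑ i, ∑ k, ∑ l, (g p)⁻¹ j i * dpart (fun q => g q i l) k p * v k * v l) -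
      (∑ i, ∑ k, ∑ l, (g p)⁻¹ j i * dpart (fun q => g q k l) i p * v k * v l) / 2 := by
    simp only [spray, mulVec, dotProduct, lowSpray_eq, mul_sub, Finset.sum_sub_distrib,
      mul_div_assoc', ← Finset.sum_div, Finset.mul_sum, mul_assoc]
  rw [h1, h2, one_div_mul_eq_div, one_div_mul_eq_div, one_div_mul_eq_div]
  rcases eq_or_ne r 0 with rfl | hr
  · simp
  · field_simp
    ring

theorem hasDerivAt_comp_dpart {n : ℕ} {f : (Fin n → ℝ) → ℝ} {x : ℝ → (Fin n → ℝ)} {t : ℝ}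
    {v : Fin n → ℝ} (hf : DifferentiableAt ℝ f (x t)) (hx : HasDerivAt x v t) :
    HasDerivAt (fun s => f (x s)) (∑ k, dpart f k (x t) * v k) t := by
  have h := hf.hasFDerivAt.comp_hasDerivAt t hx
  have e : fderiv ℝ f (x t) v = ∑ k, dpart f k (x t) * v k := by
    conv_lhs => rw [pi_eq_sum_univ' v]
    simp [dpart, mul_comm]
  rwa [e] at h

section Datum

variable {n : ℕ} {U : Set (Fin n → ℝ)} {g : (Fin n → ℝ) → Matrix (Fin n) (Fin n) ℝ}
  {ω : (Fin n → ℝ) → (Fin n → ℝ)}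

theorem IsRandersDatum.contDiffAt_metric (h : IsRandersDatum U g ω) (hU : IsOpen U)
    {p : Fin n → ℝ} (hp : p ∈ U) (i j : Fin n) : ContDiffAt ℝ 2 (fun q => g q i j) p :=
  (h.2.1 i j).contDiffAt (hU.mem_nhds hp)

theorem IsRandersDatum.contDiffAt_form (h : IsRandersDatum U g ω) (hU : IsOpen U)
    {p : Fin n → ℝ} (hp : p ∈ U) (i : Fin n) : ContDiffAt ℝ 2 (fun q => ω q i) p :=
  (h.2.2 i).contDiffAt (hU.mem_nhds hp)

theorem IsRandersDatum.hasDerivAt_metric (h : IsRandersDatum U g ω) (hU : IsOpen U)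
    {x : ℝ → (Fin n → ℝ)} {t : ℝ} {v : Fin n → ℝ} (hp : x t ∈ U) (hx : HasDerivAt x v t)
    (i j : Fin n) : HasDerivAt (fun s => g (x s) i j) (dirDeriv g (x t) v i j) t :=
  hasDerivAt_comp_dpart ((h.contDiffAt_metric hU hp i j).differentiableAt two_ne_zero) hx

/-- The derivative of the squared speed along a curve. -/
theorem IsRandersDatum.hasDerivAt_quadratic (h : IsRandersDatum U g ω) (hU : IsOpen U)
    {x y : ℝ → (Fin n → ℝ)} {t : ℝ} {a : Fin n → ℝ} (hp : x t ∈ U)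
    (hx : HasDerivAt x (y t) t) (hy : HasDerivAt y a t) :
    HasDerivAt (fun s => y s ⬝ᵥ g (x s) *ᵥ y s)
      (2 * (y t ⬝ᵥ (lowSpray g (x t) (y t) + g (x t) *ᵥ a))) t := by
  have hy' := hasDerivAt_pi.mp hy
  have h1 : HasDerivAt (fun s => ∑ i, y s i * ∑ j, g (x s) i j * y s j)
      (∑ i, (a i * (∑ j, g (x t) i j * y t j) + y t i * ∑ j,
        (dirDeriv g (x t) (y t) i j * y t j + g (x t) i j * a j))) t :=
    HasDerivAt.fun_sum fun i _ => (hy' i).mul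
      (HasDerivAt.fun_sum fun j _ => (h.hasDerivAt_metric hU hp hx i j).mul (hy' j))
  suffices e : _ = _ from h1.congr_deriv e
  symm
  have h2 := dotProduct_mulVec_comm_of_isSymm (h.1 _ hp).1 a (y t)
  have h3 := dotProduct_lowSpray g (x t) (y t)
  rw [dotProduct_add, h3]
  simp only [Finset.sum_add_distrib, mul_add]
  change 2 * (_ / 2) + _ = a ⬝ᵥ g (x t) *ᵥ y t + (y t ⬝ᵥ dirDeriv g (x t) (y t) *ᵥ y t +
    y t ⬝ᵥ g (x t) *ᵥ a)
  rw [h2]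
  ring

theorem IsRandersDatum.lowSpray_add_mulVec_accel (h : IsRandersDatum U g ω) {p : Fin n → ℝ}
    (hp : p ∈ U) (v : Fin n → ℝ) :
    lowSpray g p v + g p *ᵥ accel g ω p v = -(√(v ⬝ᵥ g p *ᵥ v) • (dform ω p *ᵥ v)) := by
  have hA := (h.1 p hp).2
  rw [accel, spray, mulVec_sub, mulVec_neg, mulVec_smul, hA.mulVec_inv_mulVec,
    hA.mulVec_inv_mulVec]
  abel

/-- Solutions of the second order equation have constant speed. -/
theorem IsRandersDatum.hasDerivAt_quadratic_zero (h : IsRandersDatum U g ω) (hU : IsOpen U)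
    {x y : ℝ → (Fin n → ℝ)} {t : ℝ} (hp : x t ∈ U)
    (hx : HasDerivAt x (y t) t) (hy : HasDerivAt y (accel g ω (x t) (y t)) t) :
    HasDerivAt (fun s => y s ⬝ᵥ g (x s) *ᵥ y s) 0 t := by
  convert h.hasDerivAt_quadratic hU hp hx hy using 1
  rw [h.lowSpray_add_mulVec_accel hp, dotProduct_neg, dotProduct_smul,
    dotProduct_mulVec_self_of_skew (dform_transpose ω _)]
  simp

/-! ### Regularity and existence of solutions -/

theorem contDiffAt_dpart {f : (Fin n → ℝ) → ℝ} {p : Fin n → ℝ} (hf : ContDiffAt ℝ 2 f p)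
    (k : Fin n) : ContDiffAt ℝ 1 (dpart f k) p :=
  (hf.fderiv_right (m := 1) (by norm_num)).clm_apply contDiffAt_const

theorem contDiffAt_det {E : Type*} [NormedAddCommGroup E] [NormedSpace ℝ E] {N : WithTop ℕ∞}
    {A : E → Matrix (Fin n) (Fin n) ℝ} {p : E} (hA : ∀ i j, ContDiffAt ℝ N (fun q => A q i j) p) :
    ContDiffAt ℝ N (fun q => (A q).det) p := by
  simp only [det_apply']
  exact ContDiffAt.sum fun σ _ => contDiffAt_const.mul (contDiffAt_prod fun i _ => hA _ _)

theorem contDiffAt_inv_apply {E : Type*} [NormedAddCommGroup E] [NormedSpace ℝ E]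
    {N : WithTop ℕ∞} {A : E → Matrix (Fin n) (Fin n) ℝ} {p : E}
    (hA : ∀ i j, ContDiffAt ℝ N (fun q => A q i j) p) (hdet : (A p).det ≠ 0) (i j : Fin n) :
    ContDiffAt ℝ N (fun q => (A q)⁻¹ i j) p := by
  have : (fun q => (A q)⁻¹ i j) = fun q => (A q).det⁻¹ * (A q).adjugate i j := by
    funext q
    simp [Matrix.inv_def]
  rw [this]
  refine ((contDiffAt_det hA).inv hdet).mul ?_
  simp only [adjugate_apply]
  refine contDiffAt_det fun k l => ?_
  simp only [updateRow_apply]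
  split_ifs
  · exact contDiffAt_const
  · exact hA k l

theorem IsRandersDatum.contDiffAt_accel (h : IsRandersDatum U g ω) (hU : IsOpen U)
    {p v : Fin n → ℝ} (hp : p ∈ U) (hv : v ≠ 0) :
    ContDiffAt ℝ 1 (fun z : (Fin n → ℝ) × (Fin n → ℝ) => accel g ω z.1 z.2) (p, v) := by
  have hsnd (i : Fin n) :
      ContDiffAt ℝ 1 (fun z : (Fin n → ℝ) × (Fin n → ℝ) => z.2 i) (p, v) := by fun_prop
  have hfst {f : (Fin n → ℝ) → ℝ} (hf : ContDiffAt ℝ 1 f p) :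
      ContDiffAt ℝ 1 (fun z : (Fin n → ℝ) × (Fin n → ℝ) => f z.1) (p, v) :=
    ContDiffAt.comp (g := f) (p, v) hf contDiffAt_fst
  have hg (i j : Fin n) : ContDiffAt ℝ 1 (fun q => g q i j) p :=
    (h.contDiffAt_metric hU hp i j).of_le (by norm_num)
  have hginv (i j : Fin n) := hfst (contDiffAt_inv_apply hg (h.1 p hp).2.det_pos.ne' i j)
  have hdg (i j k : Fin n) := contDiffAt_dpart (h.contDiffAt_metric hU hp i j) k
  have hdω (i k : Fin n) := contDiffAt_dpart (h.contDiffAt_form hU hp i) k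
  refine contDiffAt_pi.mpr fun j => ?_
  simp only [accel, spray, lowSpray, christoffel, Pi.sub_apply, Pi.neg_apply, Pi.smul_apply,
    smul_eq_mul, mulVec, dotProduct, dform, of_apply]
  refine ContDiffAt.sub (ContDiffAt.neg ?_) (ContDiffAt.mul ?_ ?_)
  · exact ContDiffAt.sum fun i _ => (hginv j i).mul (ContDiffAt.sum fun k _ =>
      ContDiffAt.sum fun l _ => ((hfst (((hdg i l k).add (hdg i k l)).sub
        (hdg k l i) |>.div_const 2)).mul (hsnd k)).mul (hsnd l))
  · refine ContDiffAt.sqrt ?_ ?_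
    · exact ContDiffAt.sum fun i _ => (hsnd i).mul (ContDiffAt.sum fun k _ =>
        (hfst (hg i k)).mul (hsnd k))
    · exact ((h.1 p hp).2.quadratic_pos hv).ne'
  · exact ContDiffAt.sum fun i _ => (hginv j i).mul (ContDiffAt.sum fun k _ =>
      (hfst ((hdω i k).sub (hdω k i))).mul (hsnd k))

/-- The local flow of the second order equation satisfied by Randers geodesics, staying in the
domain, and continuous in the initial condition. -/
theorem IsRandersDatum.exists_local_flow (h : IsRandersDatum U g ω) (hU : IsOpen U)
    {p v : Fin n → ℝ} (hp : p ∈ U) (hv : v ≠ 0) :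
    ∃ ε > 0, ∃ r > 0, ∃ x y : (Fin n → ℝ) × (Fin n → ℝ) → ℝ → (Fin n → ℝ),
      (∀ z ∈ Metric.closedBall (p, v) r, x z 0 = z.1 ∧ y z 0 = z.2 ∧ ∀ t ∈ Set.Ioo (-ε) ε,
        HasDerivAt (x z) (y z t) t ∧ HasDerivAt (y z) (accel g ω (x z t) (y z t)) t ∧
        x z t ∈ U ∧ y z t ≠ 0) ∧
      ∀ t ∈ Set.Ioo (-ε) ε, ContinuousOn (x · t) (Metric.closedBall (p, v) r) := by
  have hF : ContDiffAt ℝ 1 (fun z : (Fin n → ℝ) × (Fin n → ℝ) => (z.2, accel g ω z.1 z.2))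
      (p, v) := contDiffAt_snd.prodMk (h.contDiffAt_accel hU hp hv)
  obtain ⟨ε, hε, a, r, L, K, hr, hPL⟩ := IsPicardLindelof.of_contDiffAt_one hF
  obtain ⟨α, hα, hαc⟩ :=
    (hPL 0).exists_forall_mem_closedBall_eq_hasDerivWithinAt_continuousOn
  simp only [zero_sub, zero_add] at hα hαc
  have hr' : (0 : ℝ) < r := hr
  have hO : IsOpen (U ×ˢ {w : Fin n → ℝ | w ≠ 0}) := hU.prod isOpen_ne
  have h0 : ((p, v), (0 : ℝ)) ∈ Metric.closedBall (p, v) (r : ℝ) ×ˢ Set.Icc (-ε) ε :=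
    ⟨Metric.mem_closedBall_self hr'.le, by constructor <;> linarith⟩
  have hα0 : α ((p, v), 0) = (p, v) := (hα (p, v) h0.1).1
  have hnhds : Metric.closedBall (p, v) (r : ℝ) ×ˢ Set.Icc (-ε) ε ∈ nhds ((p, v), (0 : ℝ)) :=
    prod_mem_nhds (Metric.closedBall_mem_nhds _ hr') (Icc_mem_nhds (by linarith) hε)
  have hev : ∀ᶠ zt in nhds ((p, v), (0 : ℝ)), α zt ∈ U ×ˢ {w : Fin n → ℝ | w ≠ 0} :=
    (hαc.continuousAt hnhds).eventually (by rw [hα0]; exact hO.mem_nhds ⟨hp, hv⟩)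
  obtain ⟨δ, hδ, hball⟩ := Metric.nhds_basis_closedBall.eventually_iff.mp hev
  have hmem {z : (Fin n → ℝ) × (Fin n → ℝ)} (hz : z ∈ Metric.closedBall (p, v) (min (r : ℝ) δ)) :
      z ∈ Metric.closedBall (p, v) (r : ℝ) :=
    Metric.closedBall_subset_closedBall (min_le_left _ _) hz
  refine ⟨min ε δ, lt_min hε hδ, min r δ, lt_min hr' hδ, fun z t => (α (z, t)).1,
    fun z t => (α (z, t)).2, fun z hz => ?_, fun t ht => ?_⟩
  · obtain ⟨e0, hd⟩ := hα z (hmem hz)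
    refine ⟨by simp only [e0], by simp only [e0], fun t ht => ?_⟩
    have htε : t ∈ Set.Ioo (-ε) ε :=
      ⟨by linarith [ht.1, min_le_left ε δ], by linarith [ht.2, min_le_left ε δ]⟩
    have hd' := (hd t (Set.Ioo_subset_Icc_self htε)).hasDerivAt (Icc_mem_nhds htε.1 htε.2)
    have hU' := hball (show (z, t) ∈ Metric.closedBall ((p, v), (0 : ℝ)) δ by
      rw [Metric.mem_closedBall, Prod.dist_eq, Real.dist_0_eq_abs]
      exact max_le (hz.trans (min_le_right _ _)) (abs_le.mpr
        ⟨by linarith [ht.1, min_le_right ε δ], by linarith [ht.2, min_le_right ε δ]⟩))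
    exact ⟨hd'.fst, hd'.snd, hU'.1, hU'.2⟩
  · have htε : t ∈ Set.Icc (-ε) ε :=
      ⟨by linarith [ht.1, min_le_left ε δ], by linarith [ht.2, min_le_left ε δ]⟩
    exact continuous_fst.comp_continuousOn (hαc.comp (by fun_prop) fun z hz => ⟨hmem hz, htε⟩)

/-- Solutions of the second order equation are Randers geodesics. -/
theorem IsRandersDatum.isRandersGeodesic (h : IsRandersDatum U g ω) (hU : IsOpen U) {a b : ℝ}
    {x y : ℝ → (Fin n → ℝ)} (hxy : ∀ t ∈ Set.Ioo a b, HasDerivAt x (y t) t ∧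
      HasDerivAt y (accel g ω (x t) (y t)) t ∧ x t ∈ U ∧ y t ≠ 0) :
    IsRandersGeodesic U g ω (Set.Ioo a b) x := by
  have hdx : ∀ t ∈ Set.Ioo a b, deriv x t = y t := fun t ht => (hxy t ht).1.deriv
  have hev {t : ℝ} (ht : t ∈ Set.Ioo a b) : deriv x =ᶠ[nhds t] y :=
    Filter.eventually_of_mem (isOpen_Ioo.mem_nhds ht) hdx
  have hddx : ∀ t ∈ Set.Ioo a b, deriv (deriv x) t = accel g ω (x t) (y t) := fun t ht => by
    rw [(hev ht).deriv_eq, (hxy t ht).2.1.deriv]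
  refine ⟨isOpen_Ioo, Set.ordConnected_Ioo, fun t ht => (hxy t ht).2.2.1, ?_, fun t ht => ?_,
    fun t ht j => ?_⟩
  · intro t ht
    have hy : ContDiffOn ℝ 1 y (Set.Ioo a b) := by
      rw [show (1 : WithTop ℕ∞) = 0 + 1 by simp, contDiffOn_succ_iff_deriv_of_isOpen isOpen_Ioo]
      refine ⟨fun t ht => (hxy t ht).2.1.differentiableAt.differentiableWithinAt, by simp, ?_⟩
      rw [contDiffOn_zero]
      intro t ht
      have hc := ((h.contDiffAt_accel hU (hxy t ht).2.2.1 (hxy t ht).2.2.2).continuousAt).comp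
        (f := fun t => (x t, y t))
        ((hxy t ht).1.continuousAt.prodMk (hxy t ht).2.1.continuousAt)
      refine (hc.congr ?_).continuousWithinAt
      exact Filter.eventually_of_mem (isOpen_Ioo.mem_nhds ht) fun s hs => (hxy s hs).2.1.deriv.symm
    have hx : ContDiffOn ℝ 2 x (Set.Ioo a b) := by
      rw [show (2 : WithTop ℕ∞) = 1 + 1 by norm_num,
        contDiffOn_succ_iff_deriv_of_isOpen isOpen_Ioo]
      exact ⟨fun t ht => (hxy t ht).1.differentiableAt.differentiableWithinAt, by simp,
        hy.congr hdx⟩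
    exact hx t ht
  · rw [hdx t ht]
    exact (hxy t ht).2.2.2
  · rw [eulerLagrange_eq]
    simp only [sum_sum_eq_quadratic]
    have hN := (h.1 _ (hxy t ht).2.2.1).2.quadratic_pos (hxy t ht).2.2.2
    have hN' := Real.sqrt_pos.mpr hN
    have hd : deriv (fun s => 1 / √(deriv x s ⬝ᵥ g (x s) *ᵥ deriv x s)) t = 0 := by
      have e : (fun s => 1 / √(deriv x s ⬝ᵥ g (x s) *ᵥ deriv x s)) =ᶠ[nhds t]
          fun s => 1 / √(y s ⬝ᵥ g (x s) *ᵥ y s) :=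
        (hev ht).mono fun s hs => by simp only [hs]
      rw [e.deriv_eq]
      have := h.hasDerivAt_quadratic_zero hU (hxy t ht).2.2.1 (hxy t ht).1 (hxy t ht).2.1
      simpa using ((this.sqrt hN.ne').fun_inv hN'.ne').deriv
    rw [hd, hddx t ht, hdx t ht]
    simp only [accel, Pi.sub_apply, Pi.neg_apply, Pi.smul_apply, smul_eq_mul]
    field_simp
    ring

/-! ### Consequences of projective equivalence -/

section TwoData

variable {gbar : (Fin n → ℝ) → Matrix (Fin n) (Fin n) ℝ} {ωbar : (Fin n → ℝ) → (Fin n → ℝ)}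

theorem exists_accel_sub_eq_smul (hU : IsOpen U) (h : IsRandersDatum U g ω)
    (hbar : IsRandersDatum U gbar ωbar)
    (hproj : ∀ (I : Set ℝ) (x : ℝ → (Fin n → ℝ)),
      IsRandersGeodesic U g ω I x → IsRandersGeodesic U gbar ωbar I x)
    {p v : Fin n → ℝ} (hp : p ∈ U) (hv : v ≠ 0) :
    ∃ μ : ℝ, accel g ω p v - accel gbar ωbar p v = μ • v := by
  obtain ⟨ε, hε, r, hr, x, y, hxy, -⟩ := h.exists_local_flow hU hp hv
  obtain ⟨hx0, hy0, hode⟩ := hxy (p, v) (Metric.mem_closedBall_self hr.le)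
  have h0 : (0 : ℝ) ∈ Set.Ioo (-ε) ε := ⟨by linarith, hε⟩
  have hgeo := (hproj _ _ (h.isRandersGeodesic hU hode)).2.2.2.2.2 0 h0
  have hdx : deriv (x (p, v)) 0 = v := by rw [(hode 0 h0).1.deriv, hy0]
  have hddx : deriv (deriv (x (p, v))) 0 = accel g ω p v := by
    have hev : deriv (x (p, v)) =ᶠ[nhds 0] y (p, v) :=
      Filter.eventually_of_mem (isOpen_Ioo.mem_nhds h0) fun t ht => (hode t ht).1.deriv
    rw [hev.deriv_eq, (hode 0 h0).2.1.deriv, hx0, hy0]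
  have hN := Real.sqrt_pos.mpr ((hbar.1 p hp).2.quadratic_pos hv)
  simp only [eulerLagrange_eq, sum_sum_eq_quadratic, hddx, hdx, hx0] at hgeo
  refine ⟨-√(v ⬝ᵥ gbar p *ᵥ v) *
    deriv (fun s => 1 / √(deriv (x (p, v)) s ⬝ᵥ gbar (x (p, v) s) *ᵥ deriv (x (p, v)) s)) 0,
    funext fun j => ?_⟩
  have hj := hgeo j
  simp only [Pi.sub_apply, Pi.smul_apply, smul_eq_mul]
  rw [show accel gbar ωbar p v j = -spray gbar p v j - √(v ⬝ᵥ gbar p *ᵥ v) *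
    ((gbar p)⁻¹ *ᵥ (dform ωbar p *ᵥ v)) j from rfl]
  field_simp at hj
  linear_combination hj

theorem spray_neg (g : (Fin n → ℝ) → Matrix (Fin n) (Fin n) ℝ) (p v : Fin n → ℝ) :
    spray g p (-v) = spray g p v := by
  have e : lowSpray g p (-v) = lowSpray g p v := by
    funext i
    simp [lowSpray]
  rw [spray, spray, e]

theorem accel_neg (g : (Fin n → ℝ) → Matrix (Fin n) (Fin n) ℝ) (ω : (Fin n → ℝ) → (Fin n → ℝ))
    (p v : Fin n → ℝ) : accel g ω p (-v) =
      -spray g p v + √(v ⬝ᵥ g p *ᵥ v) • ((g p)⁻¹ *ᵥ (dform ω p *ᵥ v)) := by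
  simp [accel, spray_neg, mulVec_neg]

/-- The even and odd parts in the velocity of the projective equivalence relation. -/
theorem exists_spray_sub_eq_smul {p : Fin n → ℝ}
    (hacc : ∀ v, v ≠ 0 → ∃ μ : ℝ, accel g ω p v - accel gbar ωbar p v = μ • v) {v : Fin n → ℝ}
    (hv : v ≠ 0) :
    (∃ μ : ℝ, spray gbar p v - spray g p v = μ • v) ∧
    ∃ μ : ℝ, √(v ⬝ᵥ g p *ᵥ v) • ((g p)⁻¹ *ᵥ (dform ω p *ᵥ v)) -
      √(v ⬝ᵥ gbar p *ᵥ v) • ((gbar p)⁻¹ *ᵥ (dform ωbar p *ᵥ v)) = μ • v := by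
  obtain ⟨μ, hμ⟩ := hacc v hv
  obtain ⟨μ', hμ'⟩ := hacc (-v) (neg_ne_zero.mpr hv)
  rw [accel_neg, accel_neg] at hμ'
  refine ⟨⟨(μ - μ') / 2, funext fun j => ?_⟩, ⟨-(μ + μ') / 2, funext fun j => ?_⟩⟩ <;>
  · have h1 := congrFun hμ j
    have h2 := congrFun hμ' j
    simp only [accel, Pi.sub_apply, Pi.add_apply, Pi.neg_apply, Pi.smul_apply, smul_eq_mul]
      at h1 h2 ⊢
    linarith

/-- A vector-valued quadratic form parallel to its argument is the product of the argument with a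
linear form, determined by a trace. -/
theorem exists_linear_of_quadratic_parallel {S : Fin n → Fin n → Fin n → ℝ}
    (hS : ∀ j k l, S j k l = S j l k)
    (h : ∀ v : Fin n → ℝ, v ≠ 0 → ∃ μ : ℝ, ∀ j : Fin n, ∑ k, ∑ l, S j k l * v k * v l = μ * v j) :
    ∃ ψ : Fin n → ℝ, (∀ (v : Fin n → ℝ) (j : Fin n),
        ∑ k, ∑ l, S j k l * v k * v l = (∑ k, ψ k * v k) * v j) ∧
      ∀ k, ∑ j, S j j k = (n + 1) / 2 * ψ k := by
  let B (j : Fin n) : Matrix (Fin n) (Fin n) ℝ := Matrix.of (S j)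
  have hB (j : Fin n) : (B j).IsSymm := by
    ext k l
    exact hS j l k
  have hq (v : Fin n → ℝ) (j : Fin n) :
      ∑ k, ∑ l, S j k l * v k * v l = v ⬝ᵥ B j *ᵥ v := sum_sum_eq_quadratic (B j) v
  simp only [hq] at h
  have hpar (v : Fin n → ℝ) (hv : v ≠ 0) (i j : Fin n) :
      (v ⬝ᵥ B i *ᵥ v) * v j = (v ⬝ᵥ B j *ᵥ v) * v i := by
    obtain ⟨μ, hμ⟩ := h v hv
    rw [hμ, hμ]
    ring
  have hsingle (i k l : Fin n) :
      (Pi.single k 1 : Fin n → ℝ) ⬝ᵥ B i *ᵥ Pi.single l 1 = S i k l := by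
    simp [B]
  have hdiag {i k : Fin n} (hik : i ≠ k) : S i k k = 0 := by
    have := hpar (Pi.single k 1) (by simp) i k
    simpa [hsingle, hik, -mulVec_single] using this
  have hline {k l : Fin n} (hkl : k ≠ l) (i j : Fin n) (s : ℝ) :
      (S i k k + 2 * S i k l * s + S i l l * s ^ 2) *
        ((Pi.single k 1 : Fin n → ℝ) j + s * (Pi.single l 1 : Fin n → ℝ) j) =
      (S j k k + 2 * S j k l * s + S j l l * s ^ 2) *
        ((Pi.single k 1 : Fin n → ℝ) i + s * (Pi.single l 1 : Fin n → ℝ) i) := by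
    have hne : (Pi.single k 1 + s • Pi.single l 1 : Fin n → ℝ) ≠ 0 := fun h0 => by
      simpa [hkl] using congrFun h0 k
    have := hpar _ hne i j
    simpa only [quadratic_along_line (hB _), hsingle, Pi.add_apply, Pi.smul_apply,
      smul_eq_mul] using this
  have hoff {i k l : Fin n} (hkl : k ≠ l) (hik : i ≠ k) (hil : i ≠ l) : S i k l = 0 := by
    have := hline hkl i k 1
    simp [hik, hil, hkl, hdiag hik, hdiag hil] at this
    exact this
  have hhalf {k l : Fin n} (hkl : k ≠ l) : S k k l = S l l l / 2 := by
    have h1 := hline hkl k l 1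
    have h2 := hline hkl k l (-1)
    simp [hkl, hkl.symm, hdiag hkl, hdiag hkl.symm] at h1 h2
    linarith
  have hform (i k l : Fin n) : S i k l =
      (if i = k then S l l l else 0) / 2 + (if i = l then S k k k else 0) / 2 := by
    by_cases hkl : k = l
    · subst hkl
      by_cases hik : i = k
      · subst hik
        simp
      · simp [hik, hdiag hik]
    · by_cases hik : i = k
      · subst hik
        simp [hkl, hhalf hkl]
      · by_cases hil : i = l
        · subst hil
          simp [hik, hS i k i, hhalf hik]
        · simp [hik, hil, hoff hkl hik hil]
  refine ⟨fun k => S k k k, fun v j => ?_, fun k => ?_⟩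
  · have e (k l : Fin n) : S j k l * v k * v l =
        (if j = k then S l l l * v l * v k else 0) / 2 +
          (if j = l then S k k k * v k * v l else 0) / 2 := by
      rw [hform j k l]
      split_ifs <;> ring
    simp only [e, Finset.sum_add_distrib, ← Finset.sum_div]
    rw [Finset.sum_comm]
    simp only [Finset.sum_ite_eq, Finset.mem_univ, if_true, ← Finset.sum_mul]
    ring
  · have e (j : Fin n) : S j j k = S k k k / 2 + (if j = k then S j j j else 0) / 2 := by
      rw [hform j j k]
      simp
    rw [Finset.sum_congr rfl fun j _ => e j]
    simp [Finset.sum_add_distrib, ← Finset.sum_div]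
    ring

theorem IsRandersDatum.christoffel_symm (h : IsRandersDatum U g ω) (hU : IsOpen U)
    {p : Fin n → ℝ} (hp : p ∈ U)
    (i k l : Fin n) : christoffel g p i k l = christoffel g p i l k := by
  have e : dpart (fun q => g q k l) i p = dpart (fun q => g q l k) i p := by
    unfold dpart
    rw [Filter.EventuallyEq.fderiv_eq
      (Filter.eventually_of_mem (hU.mem_nhds hp) fun q hq => ((h.1 q hq).1.apply k l).symm)]
  rw [christoffel, christoffel, e]
  ring

theorem IsRandersDatum.trace_christoffel (h : IsRandersDatum U g ω) {p : Fin n → ℝ} (hp : p ∈ U)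
    (k : Fin n) : ∑ j, ∑ i, (g p)⁻¹ j i * christoffel g p i j k =
      (∑ j, ∑ i, (g p)⁻¹ j i * dpart (fun q => g q i j) k p) / 2 := by
  have hs (i j : Fin n) : (g p)⁻¹ i j = (g p)⁻¹ j i := (h.1 p hp).1.inv.apply j i
  have e : ∑ j, ∑ i, (g p)⁻¹ j i * dpart (fun q => g q j k) i p =
      ∑ j, ∑ i, (g p)⁻¹ j i * dpart (fun q => g q i k) j p := by
    rw [Finset.sum_comm]
    exact Finset.sum_congr rfl fun i _ => Finset.sum_congr rfl fun j _ => by rw [hs]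
  simp only [christoffel, mul_div_assoc', ← Finset.sum_div, mul_add, mul_sub,
    Finset.sum_add_distrib, Finset.sum_sub_distrib, e]
  ring

/-- The difference of two projectively equivalent sprays, together with Weyl's formula for the
projective factor. -/
theorem exists_projective_factor (hU : IsOpen U) (h : IsRandersDatum U g ω)
    (hbar : IsRandersDatum U gbar ωbar) {p : Fin n → ℝ} (hp : p ∈ U)
    (hs : ∀ v, v ≠ 0 → ∃ μ : ℝ, spray gbar p v - spray g p v = μ • v) (v : Fin n → ℝ) :
    ∃ μ : ℝ, spray gbar p v - spray g p v = μ • v ∧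
      trace ((gbar p)⁻¹ * dirDeriv gbar p v) - trace ((g p)⁻¹ * dirDeriv g p v) =
        (n + 1) * μ := by
  let S (j k l : Fin n) : ℝ := (∑ i, (gbar p)⁻¹ j i * christoffel gbar p i k l) -
    ∑ i, (g p)⁻¹ j i * christoffel g p i k l
  have hspray (g : (Fin n → ℝ) → Matrix (Fin n) (Fin n) ℝ) (v : Fin n → ℝ) (j : Fin n) :
      spray g p v j = ∑ k, ∑ l, (∑ i, (g p)⁻¹ j i * christoffel g p i k l) * v k * v l := by
    simp only [spray, mulVec, dotProduct, lowSpray, Finset.mul_sum, Finset.sum_mul]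
    rw [Finset.sum_comm]
    refine Finset.sum_congr rfl fun k _ => ?_
    rw [Finset.sum_comm]
    exact Finset.sum_congr rfl fun l _ => Finset.sum_congr rfl fun i _ => by ring
  have hSv (v : Fin n → ℝ) (j : Fin n) :
      ∑ k, ∑ l, S j k l * v k * v l = spray gbar p v j - spray g p v j := by
    simp only [hspray, S, sub_mul, Finset.sum_sub_distrib]
  have htr (g : (Fin n → ℝ) → Matrix (Fin n) (Fin n) ℝ) : trace ((g p)⁻¹ * dirDeriv g p v) =
      ∑ k, (∑ j, ∑ i, (g p)⁻¹ j i * dpart (fun q => g q i j) k p) * v k := by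
    simp only [trace, diag_apply, mul_apply, dirDeriv, of_apply, Finset.mul_sum, Finset.sum_mul]
    rw [Finset.sum_comm_cycle]
    simp only [mul_assoc]
  obtain ⟨ψ, hψ, hψtr⟩ := exists_linear_of_quadratic_parallel (S := S)
    (fun j k l => by simp only [S, h.christoffel_symm hU hp _ k l,
      hbar.christoffel_symm hU hp _ k l])
    (fun v hv => by
      obtain ⟨μ, hμ⟩ := hs v hv
      exact ⟨μ, fun j => by rw [hSv]; exact congrFun hμ j⟩)
  refine ⟨∑ k, ψ k * v k, funext fun j => ?_, ?_⟩
  · rw [Pi.sub_apply, ← hSv, hψ]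
    rfl
  · rw [htr, htr, ← Finset.sum_sub_distrib, Finset.mul_sum]
    refine Finset.sum_congr rfl fun k _ => ?_
    have := hψtr k
    simp only [S, Finset.sum_sub_distrib, h.trace_christoffel hp, hbar.trace_christoffel hp] at this
    linear_combination 2 * v k * this

/-- Jacobi's formula for the derivative of a determinant. -/
theorem hasDerivAt_det {A : ℝ → Matrix (Fin n) (Fin n) ℝ} {A' : Matrix (Fin n) (Fin n) ℝ} {t : ℝ}
    (hA : ∀ i j, HasDerivAt (fun s => A s i j) (A' i j) t) (hdet : (A t).det ≠ 0) :
    HasDerivAt (fun s => (A s).det) ((A t).det * trace ((A t)⁻¹ * A')) t := by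
  have h1 : HasDerivAt (fun s => (A s).det)
      (∑ σ : Equiv.Perm (Fin n), (Equiv.Perm.sign σ : ℝ) *
        ∑ i, (∏ j ∈ Finset.univ.erase i, A t (σ j) j) • A' (σ i) i) t := by
    simp only [det_apply']
    exact HasDerivAt.fun_sum fun σ _ =>
      (HasDerivAt.fun_finsetProd fun i _ => hA (σ i) i).const_mul _
  refine h1.congr_deriv ?_
  have h2 : (A t).det * trace ((A t)⁻¹ * A') = trace ((A t).adjugate * A') := by
    rw [inv_def, Ring.inverse_eq_inv', smul_mul, trace_smul, smul_eq_mul,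
      mul_inv_cancel_left₀ hdet]
  have h3 (i : Fin n) : ((A t).adjugate * A') i i =
      ((A t).updateCol i fun k => A' k i).det := by
    rw [← cramer_apply, cramer_eq_adjugate_mulVec]
    rfl
  rw [h2, trace]
  simp only [diag_apply, h3, det_apply', Finset.mul_sum]
  rw [Finset.sum_comm]
  refine Finset.sum_congr rfl fun i _ => Finset.sum_congr rfl fun σ _ => ?_
  rw [← Finset.prod_erase_mul _ _ (Finset.mem_univ i), updateCol_self, smul_eq_mul]
  congr 2
  exact Finset.prod_congr rfl fun j hj => by rw [updateCol_ne (Finset.ne_of_mem_erase hj)]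

/-- Painlevé's first integral of the geodesic flow of `g` for a projectively equivalent
metric `gbar`. -/
noncomputable def painleve (g gbar : (Fin n → ℝ) → Matrix (Fin n) (Fin n) ℝ)
    (p v : Fin n → ℝ) : ℝ :=
  (v ⬝ᵥ gbar p *ᵥ v) ^ (n + 1) * ((g p).det / (gbar p).det) ^ 2

theorem accel_zero (g : (Fin n → ℝ) → Matrix (Fin n) (Fin n) ℝ) (p v : Fin n → ℝ) :
    accel g 0 p v = -spray g p v := by
  have : dform (0 : (Fin n → ℝ) → (Fin n → ℝ)) p = 0 := by
    ext i j
    simp [dform, dpart]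
  simp [accel, this]

theorem IsRandersDatum.zero_form (h : IsRandersDatum U g ω) : IsRandersDatum U g 0 :=
  ⟨h.1, h.2.1, fun _ => contDiffOn_const⟩

theorem hasDerivAt_painleve (hU : IsOpen U) (h : IsRandersDatum U g ω)
    (hbar : IsRandersDatum U gbar ωbar)
    (hs : ∀ p ∈ U, ∀ v, v ≠ 0 → ∃ μ : ℝ, spray gbar p v - spray g p v = μ • v)
    {x y : ℝ → (Fin n → ℝ)} {t : ℝ} (hp : x t ∈ U) (hx : HasDerivAt x (y t) t)
    (hy : HasDerivAt y (accel g 0 (x t) (y t)) t) :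
    HasDerivAt (fun s => painleve g gbar (x s) (y s)) 0 t := by
  obtain ⟨μ, hμ, htr⟩ := exists_projective_factor hU h hbar hp (hs _ hp) (y t)
  have hA' := (hbar.1 _ hp).2
  have hd := (h.1 _ hp).2.det_pos.ne'
  have hd' := hA'.det_pos.ne'
  have h1 := hbar.hasDerivAt_quadratic hU hp hx hy
  have e : 2 * (y t ⬝ᵥ (lowSpray gbar (x t) (y t) + gbar (x t) *ᵥ accel g 0 (x t) (y t))) =
      2 * μ * (y t ⬝ᵥ gbar (x t) *ᵥ y t) := by
    have : lowSpray gbar (x t) (y t) = gbar (x t) *ᵥ spray gbar (x t) (y t) :=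
      (hA'.mulVec_inv_mulVec _).symm
    rw [this, accel_zero, ← mulVec_add, ← sub_eq_add_neg, hμ, mulVec_smul, dotProduct_smul,
      smul_eq_mul, mul_assoc]
  rw [e] at h1
  have h2 := hasDerivAt_det (h.hasDerivAt_metric hU hp hx) hd
  have h3 := hasDerivAt_det (hbar.hasDerivAt_metric hU hp hx) hd'
  refine ((h1.fun_pow (n + 1)).fun_mul ((h2.fun_div h3 hd').fun_pow 2)).congr_deriv ?_
  have htr' := sub_eq_iff_eq_add.mp htr
  rw [htr']
  push_cast
  field_simp
  ring

theorem painleve_of_eq_smul {p : Fin n → ℝ} (hp : (gbar p).PosDef) {φ : ℝ}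
    (e : g p = φ • gbar p) (v : Fin n → ℝ) :
    painleve g gbar p v * φ ^ (n + 1) = (v ⬝ᵥ g p *ᵥ v) ^ (n + 1) * φ ^ (2 * n) := by
  rw [painleve, e, det_smul, Fintype.card_fin, mul_div_cancel_right₀ _ hp.det_pos.ne',
    smul_mulVec, dotProduct_smul, smul_eq_mul]
  ring

theorem eq_one_of_pow_eq_pow {u : ℝ} (hn : 2 ≤ n) (hu : 0 < u) (h : u ^ (n + 1) = u ^ (2 * n)) :
    u = 1 := by
  rw [show 2 * n = n + 1 + (n - 1) by omega, pow_add u (n + 1)] at h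
  have h1 : u ^ (n - 1) = 1 :=
    mul_left_cancel₀ (pow_ne_zero (n + 1) hu.ne') (by rw [← h, mul_one])
  exact (pow_eq_one_iff_of_nonneg hu.le (by omega)).mp h1

theorem eq_smul_of_painleve (hn : 2 ≤ n) (h : IsRandersDatum U g ω)
    (hbar : IsRandersDatum U gbar ωbar) {p : Fin n → ℝ} (hp : p ∈ U) {φ : ℝ} (hφ : 0 < φ)
    {O : Set (Fin n → ℝ)} (hO : IsOpen O) {v₀ : Fin n → ℝ} (hv₀ : v₀ ∈ O)
    (hpain : ∀ v ∈ O, painleve g gbar p v * φ ^ (n + 1) =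
      (v ⬝ᵥ g p *ᵥ v) ^ (n + 1) * φ ^ (2 * n)) : g p = φ • gbar p := by
  have hA := (h.1 p hp).2
  have hA' := (hbar.1 p hp).2
  have hd := hA.det_pos
  have hd' := hA'.det_pos
  obtain ⟨κ, hκ, hκn⟩ : ∃ κ : ℝ, 0 < κ ∧
      κ ^ (n + 1) = φ ^ (2 * n) / (φ ^ (n + 1) * ((g p).det / (gbar p).det) ^ 2) := by
    have ha : 0 < φ ^ (2 * n) / (φ ^ (n + 1) * ((g p).det / (gbar p).det) ^ 2) := by positivity
    exact ⟨_, Real.rpow_pos_of_pos ha _, Real.rpow_inv_natCast_pow ha.le n.succ_ne_zero⟩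
  have hnonneg {A : Matrix (Fin n) (Fin n) ℝ} (hA : A.PosDef) (v : Fin n → ℝ) :
      0 ≤ v ⬝ᵥ A *ᵥ v := by
    rcases eq_or_ne v 0 with rfl | hv
    · simp
    · exact (hA.quadratic_pos hv).le
  have hquad : ∀ v ∈ O, v ⬝ᵥ gbar p *ᵥ v = κ * (v ⬝ᵥ g p *ᵥ v) := fun v hv => by
    refine (pow_left_inj₀ (hnonneg hA' v) (mul_nonneg hκ.le (hnonneg hA v)) n.succ_ne_zero).mp ?_
    have := hpain v hv
    rw [painleve] at this
    rw [Nat.succ_eq_add_one, mul_pow, hκn]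
    field_simp at this ⊢
    linear_combination this
  have hprop : gbar p = κ • g p := by
    rw [← sub_eq_zero]
    refine ((hbar.1 p hp).1.sub ((h.1 p hp).1.smul κ)).eq_zero_of_quadratic_eq_zero hO hv₀
      fun v hv => ?_
    rw [sub_mulVec, smul_mulVec, dotProduct_sub, dotProduct_smul, hquad v hv, smul_eq_mul, sub_self]
  have hone : φ * κ = 1 := by
    refine eq_one_of_pow_eq_pow hn (mul_pos hφ hκ) ?_
    rw [mul_pow φ κ (n + 1), hκn, hprop, det_smul, Fintype.card_fin]
    field_simp
    ring
  rw [hprop, smul_smul, hone, one_smul]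

/-- The speed and Painlevé's integral are conserved along geodesics of `g`. -/
theorem conserved_along_geodesic (hU : IsOpen U) (h : IsRandersDatum U g ω)
    (hbar : IsRandersDatum U gbar ωbar)
    (hs : ∀ p ∈ U, ∀ v, v ≠ 0 → ∃ μ : ℝ, spray gbar p v - spray g p v = μ • v)
    {ε : ℝ} {x y : ℝ → (Fin n → ℝ)} (hxy : ∀ t ∈ Set.Ioo (-ε) ε, HasDerivAt x (y t) t ∧
      HasDerivAt y (accel g 0 (x t) (y t)) t ∧ x t ∈ U ∧ y t ≠ 0)
    {t : ℝ} (ht : t ∈ Set.Ioo (-ε) ε) :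
    y t ⬝ᵥ g (x t) *ᵥ y t = y 0 ⬝ᵥ g (x 0) *ᵥ y 0 ∧
      painleve g gbar (x t) (y t) = painleve g gbar (x 0) (y 0) := by
  have h0 : (0 : ℝ) ∈ Set.Ioo (-ε) ε := by
    have := ht.1.trans ht.2
    constructor <;> linarith
  have hconst {f : ℝ → ℝ} (hf : ∀ s ∈ Set.Ioo (-ε) ε, HasDerivAt f 0 s) : f t = f 0 :=
    isOpen_Ioo.is_const_of_deriv_eq_zero isPreconnected_Ioo
      (fun s hs => (hf s hs).differentiableAt.differentiableWithinAt)
      (fun s hs => (hf s hs).deriv) ht h0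
  exact ⟨hconst fun s hs => h.zero_form.hasDerivAt_quadratic_zero hU (hxy s hs).2.2.1
      (hxy s hs).1 (hxy s hs).2.1,
    hconst fun s hs' => hasDerivAt_painleve hU h hbar hs (hxy s hs').2.2.1
      (hxy s hs').1 (hxy s hs').2.1⟩

/-- Two conformal metrics with the same unparametrized geodesics are homothetic, locally. -/
theorem eventually_eq_smul_of_conformal (hn : 2 ≤ n) (hU : IsOpen U) (h : IsRandersDatum U g ω)
    (hbar : IsRandersDatum U gbar ωbar)
    (hs : ∀ p ∈ U, ∀ v, v ≠ 0 → ∃ μ : ℝ, spray gbar p v - spray g p v = μ • v)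
    {p : Fin n → ℝ} (hp : p ∈ U) (hconf : ∀ᶠ q in nhds p, ∃ φ : ℝ, 0 < φ ∧ g q = φ • gbar q) :
    ∃ φ : ℝ, 0 < φ ∧ ∀ᶠ q in nhds p, g q = φ • gbar q := by
  obtain ⟨r, hr, hball⟩ := Metric.eventually_nhds_iff_ball.mp (hconf.and (hU.mem_nhds hp))
  let i : Fin n := ⟨0, by omega⟩
  let φ (q : Fin n → ℝ) : ℝ := g q i i / gbar q i i
  have hpos {q} (hq : q ∈ Metric.ball p r) : gbar q i i ≠ 0 :=
    ((hbar.1 q (hball q hq).2).2.diag_pos).ne'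
  have hφ {q} (hq : q ∈ Metric.ball p r) : 0 < φ q ∧ g q = φ q • gbar q := by
    obtain ⟨a, ha, e⟩ := (hball q hq).1
    have : φ q = a := by
      simp only [φ, e, Matrix.smul_apply, smul_eq_mul]
      exact mul_div_cancel_right₀ _ (hpos hq)
    rw [this]
    exact ⟨ha, e⟩
  have hdiff {q} (hq : q ∈ Metric.ball p r) : DifferentiableAt ℝ φ q := by
    have h1 := (h.contDiffAt_metric hU (hball q hq).2 i i).differentiableAt two_ne_zero
    have h2 := (hbar.contDiffAt_metric hU (hball q hq).2 i i).differentiableAt two_ne_zero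
    simpa only [φ, div_eq_mul_inv] using h1.fun_mul (h2.fun_inv (hpos hq))
  have hfd {q} (hq : q ∈ Metric.ball p r) : fderiv ℝ φ q = 0 := by
    ext1 v
    rcases eq_or_ne v 0 with rfl | hv
    · simp
    obtain ⟨ε, hε, δ, hδ, x, y, hxy, -⟩ := h.zero_form.exists_local_flow hU (hball q hq).2 hv
    obtain ⟨hx0, hy0, hode⟩ := hxy (q, v) (Metric.mem_closedBall_self hδ.le)
    have h0 : (0 : ℝ) ∈ Set.Ioo (-ε) ε := ⟨by linarith, hε⟩
    have hev : ∀ᶠ t in nhds (0 : ℝ), φ (x (q, v) t) = φ q := by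
      have hx : ∀ᶠ t in nhds (0 : ℝ), x (q, v) t ∈ Metric.ball p r :=
        (hode 0 h0).1.continuousAt.eventually (by rw [hx0]; exact Metric.isOpen_ball.mem_nhds hq)
      filter_upwards [hx, isOpen_Ioo.mem_nhds h0] with t ht htε
      obtain ⟨hN, hJ⟩ := conserved_along_geodesic hU h hbar hs hode htε
      rw [hx0, hy0] at hN hJ
      have e1 := painleve_of_eq_smul (hbar.1 _ (hball _ ht).2).2 (hφ ht).2 (y (q, v) t)
      have e2 := painleve_of_eq_smul (hbar.1 _ (hball _ hq).2).2 (hφ hq).2 v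
      rw [hN, hJ] at e1
      have hNpos := pow_pos ((h.1 q (hball q hq).2).2.quadratic_pos hv) (n + 1)
      have ha := (hφ ht).1
      have hb := (hφ hq).1
      generalize φ (x (q, v) t) = a at *
      generalize φ q = b at *
      refine (div_eq_one_iff_eq hb.ne').mp (eq_one_of_pow_eq_pow hn (div_pos ha hb) ?_)
      rw [div_pow a b (n + 1), div_pow a b (2 * n),
        div_eq_div_iff (pow_pos hb _).ne' (pow_pos hb _).ne']
      refine mul_left_cancel₀ hNpos.ne' ?_
      linear_combination b ^ (n + 1) * e1 - a ^ (n + 1) * e2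
    have hd := (hdiff (q := x (q, v) 0) (by rwa [hx0])).hasFDerivAt.comp_hasDerivAt 0 (hode 0 h0).1
    rw [hx0, hy0] at hd
    exact hd.unique ((hasDerivAt_const (0 : ℝ) (φ q)).congr_of_eventuallyEq hev)
  refine ⟨φ p, (hφ (Metric.mem_ball_self hr)).1,
    Filter.eventually_of_mem (Metric.ball_mem_nhds p hr) fun q hq => ?_⟩
  rw [← Metric.isOpen_ball.is_const_of_fderiv_eq_zero (convex_ball p r).isPreconnected
    (fun q hq => (hdiff hq).differentiableWithinAt) (fun q hq => hfd hq) hq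
    (Metric.mem_ball_self hr)]
  exact (hφ hq).2

/-- Homothety of projectively equivalent metrics propagates from a ball to its boundary, along
the geodesics entering the ball. -/
theorem eventually_eq_smul_of_ball (hn : 2 ≤ n) (hU : IsOpen U) (h : IsRandersDatum U g ω)
    (hbar : IsRandersDatum U gbar ωbar)
    (hs : ∀ p ∈ U, ∀ v, v ≠ 0 → ∃ μ : ℝ, spray gbar p v - spray g p v = μ • v)
    {φ : ℝ} (hφ : 0 < φ) {p w : Fin n → ℝ} (hp : p ∈ U) (hwp : w ≠ p)
    (hball : ∀ q ∈ Metric.ball w (dist w p), g q = φ • gbar q) :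
    ∀ᶠ q in nhds p, g q = φ • gbar q := by
  have hr : 0 < dist w p := dist_pos.mpr hwp
  obtain ⟨ε, hε, δ, hδ, x, y, hxy, hcont⟩ :=
    h.zero_form.exists_local_flow hU hp (sub_ne_zero.mpr hwp)
  obtain ⟨hx0, hy0, hode⟩ := hxy (p, w - p) (Metric.mem_closedBall_self hδ.le)
  have h0 : (0 : ℝ) ∈ Set.Ioo (-ε) ε := ⟨by linarith, hε⟩
  obtain ⟨t, ht, htball⟩ : ∃ t ∈ Set.Ioo (-ε) ε,
      x (p, w - p) t ∈ Metric.ball w (dist w p) := by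
    have ho := (hasDerivAt_iff_isLittleO.mp (hode 0 h0).1).def (half_pos hr)
    have hsmall : Set.Ioo 0 (min ε 1) ∈ nhdsWithin (0 : ℝ) (Set.Ioi 0) :=
      Ioo_mem_nhdsGT (lt_min hε one_pos)
    obtain ⟨t, ht, htIoo⟩ := ((ho.filter_mono nhdsWithin_le_nhds).and hsmall).exists
    have htε := htIoo.2.trans_le (min_le_left ε 1)
    have ht1 := htIoo.2.trans_le (min_le_right ε 1)
    have ht0 := htIoo.1
    refine ⟨t, ⟨by linarith, htε⟩, ?_⟩
    rw [hx0, hy0, sub_zero, Real.norm_of_nonneg ht0.le] at ht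
    rw [mem_ball_iff_norm]
    have e : x (p, w - p) t - w = (x (p, w - p) t - p - t • (w - p)) - (1 - t) • (w - p) := by
      module
    have hn2 : ‖(1 - t) • (w - p)‖ = (1 - t) * dist w p := by
      rw [norm_smul, Real.norm_of_nonneg (by linarith), dist_eq_norm]
    calc ‖x (p, w - p) t - w‖ ≤ dist w p / 2 * t + (1 - t) * dist w p := by
          rw [e, ← hn2]
          exact (norm_sub_le _ _).trans (by gcongr)
      _ < dist w p := by nlinarith
  have hz : ∀ᶠ z in nhds (p, w - p), x z t ∈ Metric.ball w (dist w p) ∧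
      z ∈ Metric.closedBall (p, w - p) δ :=
    (((hcont t ht).continuousAt (Metric.closedBall_mem_nhds _ hδ)).eventually
      (Metric.isOpen_ball.mem_nhds htball)).and (Metric.closedBall_mem_nhds _ hδ)
  filter_upwards [hz.curry_nhds, hU.mem_nhds hp] with q hq hqU
  obtain ⟨O, hOv, hO, hv⟩ := eventually_nhds_iff.mp hq
  refine eq_smul_of_painleve hn h hbar hqU hφ hO hv fun v hv => ?_
  obtain ⟨hxv, hzv⟩ := hOv v hv
  obtain ⟨hx0', hy0', hode'⟩ := hxy (q, v) hzv
  obtain ⟨hN, hJ⟩ := conserved_along_geodesic hU h hbar hs hode' ht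
  rw [hx0', hy0'] at hN hJ
  rw [← hN, ← hJ]
  exact painleve_of_eq_smul (hbar.1 _ (hode' t ht).2.2.1).2 (hball _ hxv) _

theorem eq_smul_of_eventually (hn : 2 ≤ n) (hU : IsOpen U) (hconn : IsPreconnected U)
    (h : IsRandersDatum U g ω) (hbar : IsRandersDatum U gbar ωbar)
    (hs : ∀ p ∈ U, ∀ v, v ≠ 0 → ∃ μ : ℝ, spray gbar p v - spray g p v = μ • v)
    {φ : ℝ} (hφ : 0 < φ) {p₀ : Fin n → ℝ} (hp₀ : p₀ ∈ U)
    (hev : ∀ᶠ q in nhds p₀, g q = φ • gbar q) : ∀ p ∈ U, g p = φ • gbar p := by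
  let W : Set (Fin n → ℝ) := interior {q | g q = φ • gbar q}
  have hWsub : W ⊆ {q | g q = φ • gbar q} := interior_subset
  suffices hUW : U ⊆ W from fun p hp => hWsub (hUW hp)
  refine hconn.subset_of_closure_inter_subset isOpen_interior
    ⟨p₀, hp₀, mem_interior_iff_mem_nhds.mpr hev⟩ ?_
  rintro p₁ ⟨hcl, hp₁⟩
  by_contra hp₁W
  obtain ⟨δ, hδ, hball⟩ := Metric.isOpen_iff.mp hU p₁ hp₁
  obtain ⟨w, hw, hwd⟩ := Metric.mem_closure_iff.mp hcl (δ / 2) (half_pos hδ)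
  have hWc : IsClosed Wᶜ := isOpen_interior.isClosed_compl
  obtain ⟨p, hp, hpd⟩ := hWc.exists_infDist_eq_dist ⟨p₁, hp₁W⟩ w
  have hle := Metric.infDist_le_dist_of_mem (x := w) (s := Wᶜ) hp₁W
  have hpU : p ∈ U := hball <| by
    have := dist_triangle_left p p₁ w
    rw [dist_comm p₁ w] at hwd
    rw [Metric.mem_ball]
    linarith
  have hwp : w ≠ p := by
    rintro rfl
    exact hp hw
  refine hp (mem_interior_iff_mem_nhds.mpr
    (eventually_eq_smul_of_ball hn hU h hbar hs hφ hpU hwp fun q hq => ?_))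
  by_contra hqW
  have := Metric.infDist_le_dist_of_mem (x := w) (s := Wᶜ) (y := q) fun hq => hqW
    (hWsub hq)
  rw [Metric.mem_ball, dist_comm] at hq
  linarith

theorem IsRandersDatum.dform_sub_smul (h : IsRandersDatum U g ω) (hbar : IsRandersDatum U gbar ωbar)
    (hU : IsOpen U) {p : Fin n → ℝ} (hp : p ∈ U) (c : ℝ) :
    dform (fun q => ω q - c • ωbar q) p = dform ω p - c • dform ωbar p := by
  have e (i k : Fin n) : dpart (fun q => (ω q - c • ωbar q) i) k p =
      dpart (fun q => ω q i) k p - c * dpart (fun q => ωbar q i) k p := by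
    have h1 := ((h.contDiffAt_form hU hp i).differentiableAt two_ne_zero).hasFDerivAt
    have h2 := ((hbar.contDiffAt_form hU hp i).differentiableAt two_ne_zero).hasFDerivAt
    have h3 := (h1.fun_sub (h2.const_mul c)).fderiv
    simp only [dpart, Pi.sub_apply, Pi.smul_apply, smul_eq_mul, h3]
    simp
  ext i k
  simp only [dform, of_apply, e, Matrix.sub_apply, Matrix.smul_apply, smul_eq_mul]
  ring

theorem IsRandersDatum.eventually_dform_ne_zero (h : IsRandersDatum U g ω) (hU : IsOpen U)
    {p : Fin n → ℝ} (hp : p ∈ U) (hne : dform ω p ≠ 0) : ∀ᶠ q in nhds p, dform ω q ≠ 0 := by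
  have hc : ContinuousAt (dform ω) p := by
    refine continuousAt_pi.mpr fun i => continuousAt_pi.mpr fun k => ?_
    exact ((contDiffAt_dpart (h.contDiffAt_form hU hp i) k).sub
      (contDiffAt_dpart (h.contDiffAt_form hU hp k) i)).continuousAt
  exact hc.eventually_ne hne

end TwoData

end Datum

/-- Theorem 1 of the paper: if two Randers data on a connected open set are projectively
equivalent and at least one of the 1-forms is not closed, then the Riemannian parts are
proportional with a constant positive coefficient and the difference of the 1-forms
(after rescaling) is closed. -/
theorem stmt_10 (n : ℕ) (hn : 2 ≤ n) (U : Set (Fin n → ℝ))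
    (hUopen : IsOpen U) (hUconn : IsConnected U)
    (g gbar : (Fin n → ℝ) → Matrix (Fin n) (Fin n) ℝ)
    (ω ωbar : (Fin n → ℝ) → (Fin n → ℝ))
    (hdatum : IsRandersDatum U g ω) (hdatumbar : IsRandersDatum U gbar ωbar)
    (hproj : ∀ (I : Set ℝ) (x : ℝ → (Fin n → ℝ)),
      IsRandersGeodesic U g ω I x → IsRandersGeodesic U gbar ωbar I x)
    (hnotclosed : ¬ IsClosedFormOn U ω ∨ ¬ IsClosedFormOn U ωbar) :
    ∃ c : ℝ, 0 < c ∧ (∀ p ∈ U, g p = (c ^ 2) • gbar p) ∧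
      IsClosedFormOn U (fun p => ω p - c • ωbar p) := by
  have hacc {p : Fin n → ℝ} (hp : p ∈ U) (v : Fin n → ℝ) (hv : v ≠ 0) :=
    exists_accel_sub_eq_smul hUopen hdatum hdatumbar hproj hp hv
  have hs (p : Fin n → ℝ) (hp : p ∈ U) (v : Fin n → ℝ) (hv : v ≠ 0) :=
    (exists_spray_sub_eq_smul (hacc hp) hv).1
  have hodd {p : Fin n → ℝ} (hp : p ∈ U) (v : Fin n → ℝ) (hv : v ≠ 0) :=
    (exists_spray_sub_eq_smul (hacc hp) hv).2
  obtain ⟨p₀, hp₀, hne⟩ : ∃ p₀ ∈ U, ∀ᶠ q in nhds p₀, dform ω q ≠ 0 ∨ dform ωbar q ≠ 0 := by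
    simp only [IsClosedFormOn] at hnotclosed
    push Not at hnotclosed
    rcases hnotclosed with ⟨p, hp, hne⟩ | ⟨p, hp, hne⟩
    · exact ⟨p, hp, (hdatum.eventually_dform_ne_zero hUopen hp hne).mono fun _ => Or.inl⟩
    · exact ⟨p, hp, (hdatumbar.eventually_dform_ne_zero hUopen hp hne).mono fun _ => Or.inr⟩
  obtain ⟨φ, hφ, hev⟩ := eventually_eq_smul_of_conformal hn hUopen hdatum hdatumbar hs hp₀ <| by
    filter_upwards [hne, hUopen.mem_nhds hp₀] with q hq hqU
    exact metrics_proportional (hdatum.1 q hqU).2 (hdatum.1 q hqU).1 (hdatumbar.1 q hqU).2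
      (hdatumbar.1 q hqU).1 (dform_transpose ω q) (dform_transpose ωbar q) (hodd hqU) hq
  have hg (p : Fin n → ℝ) (hp : p ∈ U) : g p = √φ ^ 2 • gbar p := by
    rw [Real.sq_sqrt hφ.le]
    exact eq_smul_of_eventually hn hUopen hUconn.isPreconnected hdatum hdatumbar hs hφ hp₀ hev p hp
  refine ⟨√φ, Real.sqrt_pos.mpr hφ, hg, fun p hp => ?_⟩
  rw [hdatum.dform_sub_smul hdatumbar hUopen hp, sub_eq_zero]
  exact skew_proportional (hdatumbar.1 p hp).2 (dform_transpose ω p) (dform_transpose ωbar p)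
    (hodd hp) (Real.sqrt_pos.mpr hφ) (hg p hp)
end
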